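/- The space of minimal cubic relations among the generalized 2×2 permanents, namely the quotient ℂ-vector space (ker Ψ̄)_3 / (R̄_1·(ker Ψ̄)_2), where R̄_1·(ker Ψ̄)_2 is the ℂ-span of all products ȳ·q with ȳ a variable of R̄ and q ∈ (ker Ψ̄)_2, has dimension [m(m+1)(m+2)(m+3)(m−1)(m−2)/72]·[n²(n+1)²(n+2)(n−1)/144] + [m²(m+1)²(m+2)(m−1)/144]·[n(n+1)(n+2)(n+3)(n−1)(n−2)/72]. -/

import Mathlib

open MvPolynomial

/-- Index set for the generalized 2×2 permanents of a generic `m × n` matrix: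
quadruples `((i,i'),(j,j'))` with `i ≤ i'` and `j ≤ j'`. -/
def PermIdx (m n : ℕ) : Type :=
  {w : (Fin m × Fin m) × (Fin n × Fin n) // w.1.1 ≤ w.1.2 ∧ w.2.1 ≤ w.2.2}

/-- The generalized 2×2 permanent
`p_{(i,i'),(j,j')} = x_{i,j} x_{i',j'} + x_{i,j'} x_{i',j}`. -/
noncomputable def perm {m n : ℕ} (w : PermIdx m n) : MvPolynomial (Fin m × Fin n) ℂ :=
  X (w.1.1.1, w.1.2.1) * X (w.1.1.2, w.1.2.2) + X (w.1.1.1, w.1.2.2) * X (w.1.1.2, w.1.2.1)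

/-- The ℂ-algebra map `Ψ̄ : R̄ → S` sending `ȳ_w` to the corresponding permanent. -/
noncomputable def PsiBar (m n : ℕ) :
    MvPolynomial (PermIdx m n) ℂ →ₐ[ℂ] MvPolynomial (Fin m × Fin n) ℂ :=
  aeval perm

/-- The degree `d` graded component of `ker Ψ̄`, as a ℂ-subspace of `R̄`. -/
noncomputable def kerPsiBarDeg (m n d : ℕ) : Submodule ℂ (MvPolynomial (PermIdx m n) ℂ) :=
  Submodule.restrictScalars ℂ (RingHom.ker (PsiBar m n)) ⊓
    homogeneousSubmodule (PermIdx m n) ℂ d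

/-- `R̄₁·(ker Ψ̄)₂`: the ℂ-span of all products `ȳ·q` with `ȳ` a variable of `R̄`
and `q ∈ (ker Ψ̄)₂`. -/
noncomputable def R1kerPsiBar2 (m n : ℕ) : Submodule ℂ (MvPolynomial (PermIdx m n) ℂ) :=
  Submodule.span ℂ {f | ∃ w : PermIdx m n, ∃ q ∈ kerPsiBarDeg m n 2, f = X w * q}



theorem sum_conj_comm {ι Kt M : Type*} [Fintype ι] [DecidableEq ι] [Fintype Kt] [AddCommMonoid M]
    (j : Kt → Equiv.Perm ι) (F : Equiv.Perm ι → M) (x : Equiv.Perm ι) :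
    ∑ s : Equiv.Perm ι, ∑ k : Kt, F (s * j k * s⁻¹ * x) =
      ∑ s : Equiv.Perm ι, ∑ k : Kt, F (x * (s * j k * s⁻¹)) := by
  rw [← Equiv.sum_comp (Equiv.mulLeft x)]
  refine Finset.sum_congr rfl fun s _ => Finset.sum_congr rfl fun k _ => ?_
  congr 1
  simp only [Equiv.coe_mulLeft]
  group

/-- The positive central operator. -/
noncomputable def Zop {ι α β Kt : Type*} [Fintype ι] [DecidableEq ι] [Fintype Kt]
    (j : Kt → Equiv.Perm ι) :
    ((ι → α) × (ι → β) → ℂ) →ₗ[ℂ] ((ι → α) × (ι → β) → ℂ) where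
  toFun φ := fun p => ∑ s : Equiv.Perm ι, ∑ k : Kt, φ (p.1, p.2 ∘ (s * j k * s⁻¹ : Equiv.Perm ι))
  map_add' := by
    intro x y; ext p; simp [Finset.sum_add_distrib]
  map_smul' := by
    intro c x; ext p; simp [Finset.mul_sum]

theorem sum_comp_perm {ι β M : Type*} [Fintype ι] [DecidableEq ι] [Fintype β] [AddCommMonoid M]
    (s : Equiv.Perm ι) (F : (ι → β) → M) : ∑ b, F (b ∘ s) = ∑ b, F b := by
  classical
  exact Equiv.sum_comp (Equiv.arrowCongr s.symm (Equiv.refl β)) F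

theorem Kform {ι β Kt : Type*} [Fintype ι] [DecidableEq ι] [Fintype β] [Group Kt] [Fintype Kt]
    (j : Kt →* Equiv.Perm ι) (f : (ι → β) → ℂ) :
    (Fintype.card Kt : ℂ) * ∑ b, star (f b) * ∑ k, f (b ∘ j k) =
      ∑ b, star (∑ k, f (b ∘ j k)) * ∑ k, f (b ∘ j k) := by
  have h : ∀ k' : Kt, ∑ b, star (f (b ∘ j k')) * ∑ k, f (b ∘ j k) =
      ∑ b, star (f b) * ∑ k, f (b ∘ j k) := by
    intro k'
    rw [← sum_comp_perm (j k') (fun b => star (f b) * ∑ k, f (b ∘ j k))]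
    refine Finset.sum_congr rfl fun b _ => ?_
    congr 1
    rw [← Equiv.sum_comp (Equiv.mulLeft k')]
    refine Finset.sum_congr rfl fun k _ => ?_
    simp [Function.comp_assoc]
  simp only [star_sum, Finset.sum_mul]
  rw [Finset.sum_comm]
  simp only [h]
  simp

theorem Zop_inj {ι α β Kt : Type*} [Fintype ι] [DecidableEq ι] [Fintype α] [Fintype β]
    [Group Kt] [Fintype Kt] (j : Kt →* Equiv.Perm ι) (φ : (ι → α) × (ι → β) → ℂ)
    (hK : ∀ k a b, φ (a, b ∘ j k) = φ (a, b)) (h0 : Zop j φ = 0) : φ = 0 := by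
  have hc : (Fintype.card Kt : ℂ) ≠ 0 := by exact_mod_cast Fintype.card_ne_zero
  have key : ∀ a, ∀ b, φ (a, b) = 0 := by
    intro a
    have h1 : (Fintype.card Kt : ℂ) * ∑ b, star (φ (a, b)) * Zop j φ (a, b) = 0 := by simp [h0]
    have h2 : (Fintype.card Kt : ℂ) * ∑ b, star (φ (a, b)) * Zop j φ (a, b) =
        ∑ s : Equiv.Perm ι, ∑ b, star (∑ k, φ (a, (b ∘ j k) ∘ (s⁻¹ : Equiv.Perm ι))) *
          ∑ k, φ (a, (b ∘ j k) ∘ (s⁻¹ : Equiv.Perm ι)) := by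
      have : ∀ s : Equiv.Perm ι, _ := fun s =>
        Kform j (fun b => φ (a, b ∘ (s⁻¹ : Equiv.Perm ι)))
      simp only [← this]
      rw [← Finset.mul_sum, Finset.sum_comm]
      congr 1
      simp only [Zop, LinearMap.coe_mk, AddHom.coe_mk, Finset.mul_sum]
      rw [Finset.sum_comm]
      conv_rhs => rw [Finset.sum_comm]
      refine Finset.sum_congr rfl fun s _ => ?_
      rw [← sum_comp_perm (s⁻¹)]
      refine Finset.sum_congr rfl fun b _ => Finset.sum_congr rfl fun k _ => ?_
      congr 3
      ext i
      simp
    rw [h1] at h2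
    have h3 : ∀ z : ℂ, star z * z = ((Complex.normSq z : ℝ) : ℂ) := fun z =>
      (Complex.normSq_eq_conj_mul_self).symm
    simp only [h3] at h2
    have h4 := h2.symm
    norm_cast at h4
    rw [Finset.sum_eq_zero_iff_of_nonneg
      (fun s _ => Finset.sum_nonneg fun b _ => Complex.normSq_nonneg _)] at h4
    have h5 := h4 1 (Finset.mem_univ _)
    rw [Finset.sum_eq_zero_iff_of_nonneg (fun b _ => Complex.normSq_nonneg _)] at h5
    intro b
    have h6 := h5 b (Finset.mem_univ _)
    rw [Complex.normSq_eq_zero] at h6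
    simpa [hK] using h6
  ext ⟨a, b⟩
  exact key a b

theorem exists_invariant {ι α β Kt : Type*} [Fintype ι] [DecidableEq ι] [Fintype α] [Fintype β]
    [Group Kt] [Fintype Kt] (j : Kt →* Equiv.Perm ι) (φ : (ι → α) × (ι → β) → ℂ)
    (hK : ∀ k a b, φ (a, b ∘ j k) = φ (a, b))
    (hbal : ∀ (s : Equiv.Perm ι) a b, ∑ k, φ (a ∘ (j k * s : Equiv.Perm ι), b) =
      ∑ k, φ (a, b ∘ (j k * s⁻¹ : Equiv.Perm ι))) :
    ∃ ψ : (ι → α) × (ι → β) → ℂ, (∀ (s : Equiv.Perm ι) a b, ψ (a ∘ s, b ∘ s) = ψ (a, b)) ∧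
      ∀ a b, φ (a, b) = ∑ k, ψ (a, b ∘ j k) := by
  classical
  let P : Submodule ℂ ((ι → α) × (ι → β) → ℂ) :=
    { carrier := {φ | (∀ k a b, φ (a, b ∘ j k) = φ (a, b)) ∧
        (∀ (s : Equiv.Perm ι) a b, ∑ k, φ (a ∘ (j k * s : Equiv.Perm ι), b) =
          ∑ k, φ (a, b ∘ (j k * s⁻¹ : Equiv.Perm ι)))}
      add_mem' := by
        rintro x y ⟨h1, h2⟩ ⟨h3, h4⟩
        exact ⟨fun k a b => by simp [h1, h3], fun s a b => by
          simp only [Pi.add_apply, Finset.sum_add_distrib, h2, h4]⟩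
      zero_mem' := by simp
      smul_mem' := by
        rintro c x ⟨h1, h2⟩
        exact ⟨fun k a b => by simp [h1], fun s a b => by
          simp only [Pi.smul_apply, ← Finset.smul_sum, h2]⟩ }
  have hstab : ∀ φ ∈ P, Zop j φ ∈ P := by
    rintro φ ⟨h1, h2⟩
    have hcomm : ∀ (x : Equiv.Perm ι) a b,
        ∑ s : Equiv.Perm ι, ∑ k, φ (a, (b ∘ (s * j k * s⁻¹ : Equiv.Perm ι)) ∘ x) =
        ∑ s : Equiv.Perm ι, ∑ k, φ (a, (b ∘ x) ∘ (s * j k * s⁻¹ : Equiv.Perm ι)) := by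
      intro x a b
      exact sum_conj_comm j (fun g => φ (a, b ∘ g)) x
    constructor
    · intro k a b
      simp only [Zop, LinearMap.coe_mk, AddHom.coe_mk]
      rw [← hcomm]
      simp only [h1]
    · intro s a b
      simp only [Zop, LinearMap.coe_mk, AddHom.coe_mk]
      rw [Finset.sum_comm]
      conv_rhs => simp only [← hcomm]
      conv_rhs => rw [Finset.sum_comm]
      refine Finset.sum_congr rfl fun s' _ => ?_
      rw [Finset.sum_comm]
      conv_rhs => rw [Finset.sum_comm]
      refine Finset.sum_congr rfl fun k' _ => ?_
      exact h2 s a _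
  let Z : P →ₗ[ℂ] P := (Zop j).restrict hstab
  have hinj : Function.Injective Z := by
    rw [← LinearMap.ker_eq_bot, LinearMap.ker_eq_bot']
    rintro ⟨x, hx⟩ h
    have : Zop j x = 0 := congrArg Subtype.val h
    exact Subtype.ext (Zop_inj j x hx.1 this)
  obtain ⟨⟨x, hx⟩, hxφ⟩ := LinearMap.surjective_of_injective hinj ⟨φ, hK, hbal⟩
  have hxφ' : Zop j x = φ := congrArg Subtype.val hxφ
  refine ⟨fun p => ∑ s : Equiv.Perm ι, x (p.1 ∘ s, p.2 ∘ s), ?_, ?_⟩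
  · intro s a b
    exact Equiv.sum_comp (Equiv.mulLeft s) (fun t : Equiv.Perm ι => x (a ∘ t, b ∘ t))
  · intro a b
    rw [← hxφ']
    simp only [Zop, LinearMap.coe_mk, AddHom.coe_mk]
    rw [Finset.sum_comm]
    conv_rhs =>
      rw [← Equiv.sum_comp (Equiv.inv Kt)]
    have : ∀ k : Kt, ∑ s : Equiv.Perm ι, x (a ∘ s, (b ∘ j ((Equiv.inv Kt) k)) ∘ s) =
        ∑ s : Equiv.Perm ι, x (a ∘ (j k * s : Equiv.Perm ι), b ∘ s) := by
      intro k
      rw [← Equiv.sum_comp (Equiv.mulLeft (j k))]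
      refine Finset.sum_congr rfl fun s _ => ?_
      congr 2
      ext i
      simp
    simp only [this]
    rw [Finset.sum_comm]
    conv_rhs => rw [Finset.sum_comm]
    refine Finset.sum_congr rfl fun s _ => ?_
    rw [hx.2 s a (b ∘ s)]
    refine Finset.sum_congr rfl fun k _ => ?_
    rfl


theorem exists_perm_of_fibers {ι I : Type*} [Fintype ι] [DecidableEq I] (w w' : ι → I)
    (h : ∀ x, Fintype.card {i // w i = x} = Fintype.card {i // w' i = x}) :
    ∃ s : Equiv.Perm ι, w' ∘ s = w := by
  let e : ι ≃ ι := (Equiv.sigmaFiberEquiv w).symm.trans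
    ((Equiv.sigmaCongrRight fun x => Fintype.equivOfCardEq (h x)).trans (Equiv.sigmaFiberEquiv w'))
  refine ⟨e, ?_⟩
  ext i
  exact ((Fintype.equivOfCardEq (h (w i))) ⟨i, rfl⟩).2

theorem prod_X_eq {ι I : Type*} [Fintype ι] (w : ι → I) :
    (∏ i, X (w i) : MvPolynomial I ℂ) = monomial (∑ i, Finsupp.single (w i) 1) 1 := by
  simp [X, ← monomial_sum_one]

theorem exists_perm_of_sum {ι I : Type*} [Fintype ι] (w w' : ι → I)
    (h : ∑ i, Finsupp.single (w i) 1 = ∑ i, Finsupp.single (w' i) (1 : ℕ)) :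
    ∃ s : Equiv.Perm ι, w' ∘ s = w := by
  classical
  apply exists_perm_of_fibers
  intro x
  have := DFunLike.congr_fun h x
  simp only [Finsupp.coe_finsetSum, Finset.sum_apply, Finsupp.single_apply, Finset.sum_boole] at this
  simpa [Fintype.card_subtype] using this

theorem exists_functional {ι I : Type*} [Fintype ι] (ψ : (ι → I) → ℂ)
    (hψ : ∀ (s : Equiv.Perm ι) w, ψ (w ∘ s) = ψ w) :
    ∃ G : MvPolynomial I ℂ →ₗ[ℂ] ℂ, ∀ w : ι → I, G (∏ i, X (w i)) = ψ w := by
  classical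
  let c : (I →₀ ℕ) → ℂ := fun s =>
    if h : ∃ w : ι → I, ∑ i, Finsupp.single (w i) 1 = s then ψ h.choose else 0
  refine ⟨(basisMonomials I ℂ).constr ℂ c, fun w => ?_⟩
  rw [prod_X_eq]
  have := (basisMonomials I ℂ).constr_basis ℂ c (∑ i, Finsupp.single (w i) 1)
  rw [coe_basisMonomials] at this
  rw [this]
  have hex : ∃ w' : ι → I, ∑ i, Finsupp.single (w' i) 1 = ∑ i, Finsupp.single (w i) 1 := ⟨w, rfl⟩
  simp only [c, dif_pos hex]
  obtain ⟨s, hs⟩ := exists_perm_of_sum _ _ hex.choose_spec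
  rw [← hs, hψ]

theorem homogeneous_span {I : Type*} (d : ℕ) (f : MvPolynomial I ℂ)
    (hf : f ∈ homogeneousSubmodule I ℂ d) :
    f ∈ Submodule.span ℂ (Set.range fun w : Fin d → I => (∏ i, X (w i) : MvPolynomial I ℂ)) := by
  classical
  rw [mem_homogeneousSubmodule] at hf
  rw [f.as_sum]
  refine Submodule.sum_mem _ fun s hs => ?_
  have hdeg := hf (mem_support_iff.mp hs)
  have : monomial s (coeff s f) = coeff s f • (monomial s 1 : MvPolynomial I ℂ) := by
    simp [smul_monomial]
  rw [this]
  refine Submodule.smul_mem _ _ (Submodule.subset_span ?_)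
  have hl : (Finsupp.toMultiset s).toList.length = d := by
    rw [Multiset.length_toList, Finsupp.card_toMultiset, ← hdeg]
    simp [Finsupp.weight_apply, Finsupp.sum]
  refine ⟨fun i => (Finsupp.toMultiset s).toList.get (i.cast hl.symm), ?_⟩
  simp only
  have h1 : (∏ i : Fin d, X ((Finsupp.toMultiset s).toList.get (i.cast hl.symm)) : MvPolynomial I ℂ) =
      ((Finsupp.toMultiset s).toList.map X).prod := by
    rw [← Fin.prod_univ_fun_getElem]
    exact (Equiv.prod_comp (finCongr hl.symm) (fun i => X ((Finsupp.toMultiset s).toList.get i)))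
  rw [h1, ← Multiset.prod_coe, ← Multiset.map_coe, Multiset.coe_toList, Finsupp.toMultiset_map,
    Finsupp.prod_toMultiset]
  rw [monomial_eq]
  simp [Finsupp.prod_mapDomain_index, pow_add]

abbrev Ix (d : ℕ) := Fin d × Fin 2

/-- Independent permutations inside the `d` blocks of size two. -/
def jK (d : ℕ) : (Fin d → Equiv.Perm (Fin 2)) →* Equiv.Perm (Ix d) where
  toFun κ := Equiv.prodCongrRight κ
  map_one' := by ext x <;> simp
  map_mul' := by intro x y; ext p <;> simp

/-- Permutations of the blocks. -/
def tS (d : ℕ) : Equiv.Perm (Fin d) →* Equiv.Perm (Ix d) where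
  toFun τ := Equiv.prodCongr τ (Equiv.refl _)
  map_one' := by ext x <;> simp
  map_mul' := by intro x y; ext p <;> simp

@[simp] theorem jK_apply (d : ℕ) (κ) (p : Ix d) : jK d κ p = (p.1, κ p.1 p.2) := rfl
@[simp] theorem tS_apply (d : ℕ) (τ) (p : Ix d) : tS d τ p = (τ p.1, p.2) := rfl

/-- The sorted quadruple. -/
def qd {m n : ℕ} (u : Fin 2 → Fin m) (v : Fin 2 → Fin n) : PermIdx m n :=
  ⟨((min (u 0) (u 1), max (u 0) (u 1)), (min (v 0) (v 1), max (v 0) (v 1))),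
    min_le_max, min_le_max⟩

def wu {m n : ℕ} (w : PermIdx m n) : Fin 2 → Fin m := ![w.1.1.1, w.1.1.2]
def wv {m n : ℕ} (w : PermIdx m n) : Fin 2 → Fin n := ![w.1.2.1, w.1.2.2]

theorem qd_wuv {m n : ℕ} (w : PermIdx m n) : qd (wu w) (wv w) = w := by
  apply Subtype.ext
  simp [qd, wu, wv, w.2.1, w.2.2]

theorem sorted_pair {m : ℕ} (u : Fin 2 → Fin m) :
    ∃ κ : Equiv.Perm (Fin 2), ![min (u 0) (u 1), max (u 0) (u 1)] = u ∘ κ := by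
  rcases le_total (u 0) (u 1) with h | h
  · refine ⟨1, ?_⟩
    ext i
    fin_cases i <;> simp [h]
  · refine ⟨Equiv.swap 0 1, ?_⟩
    ext i
    fin_cases i <;> simp [h]

theorem wu_qd {m n : ℕ} (u : Fin 2 → Fin m) (v : Fin 2 → Fin n) :
    ∃ κ : Equiv.Perm (Fin 2), wu (qd u v) = u ∘ κ := sorted_pair u
theorem wv_qd {m n : ℕ} (u : Fin 2 → Fin m) (v : Fin 2 → Fin n) :
    ∃ κ : Equiv.Perm (Fin 2), wv (qd u v) = v ∘ κ := sorted_pair v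

theorem sum_perm2 {M : Type*} [AddCommMonoid M] (F : Equiv.Perm (Fin 2) → M) :
    ∑ κ, F κ = F 1 + F (Equiv.swap 0 1) := by
  have : (Finset.univ : Finset (Equiv.Perm (Fin 2))) = {1, Equiv.swap 0 1} := by decide
  rw [this, Finset.sum_pair (by decide)]

theorem Psi_qd {m n : ℕ} (u : Fin 2 → Fin m) (v : Fin 2 → Fin n) :
    PsiBar m n (X (qd u v)) = ∑ κ : Equiv.Perm (Fin 2), ∏ i, X (u i, v (κ i)) := by
  rw [sum_perm2]
  rw [show PsiBar m n (X (qd u v)) = perm (qd u v) from aeval_X _ _]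
  simp only [perm, qd, Fin.prod_univ_two]
  rcases le_total (u 0) (u 1) with h | h <;> rcases le_total (v 0) (v 1) with h' | h' <;>
    simp [h, h'] <;> ring

/-- Monomial of degree `d` attached to a pair of words. -/
noncomputable def mon {m n : ℕ} (d : ℕ) (a : Ix d → Fin m) (b : Ix d → Fin n) :
    MvPolynomial (PermIdx m n) ℂ :=
  ∏ i, X (qd (fun j => a (i, j)) (fun j => b (i, j)))

theorem Psi_mon {m n : ℕ} (d : ℕ) (a : Ix d → Fin m) (b : Ix d → Fin n) :
    PsiBar m n (mon d a b) = ∑ κ, ∏ p, X (a p, (b ∘ jK d κ) p) := by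
  simp only [mon, map_prod, Psi_qd]
  rw [Finset.prod_univ_sum]
  simp only [Fintype.piFinset_univ]
  refine Finset.sum_congr rfl fun κ _ => ?_
  rw [Fintype.prod_prod_type]
  rfl

theorem mon_span {m n : ℕ} (d : ℕ) (f : MvPolynomial (PermIdx m n) ℂ)
    (hf : f ∈ homogeneousSubmodule (PermIdx m n) ℂ d) :
    f ∈ Submodule.span ℂ (Set.range fun p : (Ix d → Fin m) × (Ix d → Fin n) => mon d p.1 p.2) := by
  refine Submodule.span_mono ?_ (homogeneous_span d f hf)
  rintro _ ⟨w, rfl⟩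
  refine ⟨(fun p => wu (w p.1) p.2, fun p => wv (w p.1) p.2), ?_⟩
  simp [mon, qd_wuv]

theorem mon_homog {m n : ℕ} (d : ℕ) (a : Ix d → Fin m) (b : Ix d → Fin n) :
    mon d a b ∈ homogeneousSubmodule (PermIdx m n) ℂ d := by
  rw [mem_homogeneousSubmodule, mon]
  have := IsHomogeneous.prod Finset.univ
    (fun i : Fin d => (X (qd (fun j => a (i, j)) (fun j => b (i, j))) : MvPolynomial (PermIdx m n) ℂ))
    (fun _ => 1) (fun i _ => isHomogeneous_X _ _)
  simpa using this

/-- Condition (i). -/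
structure WInv {m n : ℕ} (d : ℕ) (φ : (Ix d → Fin m) × (Ix d → Fin n) → ℂ) : Prop where
  ka : ∀ κ a b, φ (a ∘ jK d κ, b) = φ (a, b)
  kb : ∀ κ a b, φ (a, b ∘ jK d κ) = φ (a, b)
  t : ∀ τ a b, φ (a ∘ tS d τ, b ∘ tS d τ) = φ (a, b)

/-- Balance at `s`. -/
def Bal {m n : ℕ} (d : ℕ) (φ : (Ix d → Fin m) × (Ix d → Fin n) → ℂ)
    (s : Equiv.Perm (Ix d)) : Prop :=
  ∀ a b, ∑ k, φ (a ∘ (jK d k * s : Equiv.Perm (Ix d)), b) =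
      ∑ k, φ (a, b ∘ (jK d k * s⁻¹ : Equiv.Perm (Ix d)))

theorem exists_F {m n d : ℕ} {φ : (Ix d → Fin m) × (Ix d → Fin n) → ℂ} (h : WInv d φ) :
    ∃ F : MvPolynomial (PermIdx m n) ℂ →ₗ[ℂ] ℂ, ∀ a b, F (mon d a b) = φ (a, b) := by
  obtain ⟨F, hF⟩ := exists_functional (ι := Fin d)
    (fun w : Fin d → PermIdx m n => φ (fun p => wu (w p.1) p.2, fun p => wv (w p.1) p.2))
    (fun s w => h.t s (fun p => wu (w p.1) p.2) (fun p => wv (w p.1) p.2))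
  refine ⟨F, fun a b => ?_⟩
  rw [mon, hF]
  choose κ hκ using fun i : Fin d => wu_qd (fun j => a (i, j)) (fun j => b (i, j))
  choose κ' hκ' using fun i : Fin d => wv_qd (fun j => a (i, j)) (fun j => b (i, j))
  rw [← h.ka κ a b, ← h.kb κ' _ b]
  congr 2
  · ext p
    simp [hκ]
  · ext p
    simp [hκ']

theorem inv_of_F {m n d : ℕ} (F : MvPolynomial (PermIdx m n) ℂ →ₗ[ℂ] ℂ) :
    WInv d (fun p : (Ix d → Fin m) × (Ix d → Fin n) => F (mon d p.1 p.2)) := by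
  have hs : ∀ {k : ℕ} (u : Fin 2 → Fin k) (κ : Equiv.Perm (Fin 2)),
      min (u (κ 0)) (u (κ 1)) = min (u 0) (u 1) ∧ max (u (κ 0)) (u (κ 1)) = max (u 0) (u 1) := by
    intro k u κ
    have : κ = 1 ∨ κ = Equiv.swap 0 1 := by revert κ; decide
    rcases this with rfl | rfl
    · simp
    · simp [min_comm, max_comm]
  constructor
  · intro κ a b
    simp only [mon]
    congr 1
    refine Finset.prod_congr rfl fun i _ => ?_
    congr 1
    apply Subtype.ext
    simp [qd, (hs (fun j => a (i, j)) (κ i)).1, (hs (fun j => a (i, j)) (κ i)).2]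
  · intro κ a b
    simp only [mon]
    congr 1
    refine Finset.prod_congr rfl fun i _ => ?_
    congr 1
    apply Subtype.ext
    simp [qd, (hs (fun j => b (i, j)) (κ i)).1, (hs (fun j => b (i, j)) (κ i)).2]
  · intro τ a b
    simp only [mon]
    congr 1
    exact Equiv.prod_comp τ
      (fun i => (X (qd (fun j => a (i, j)) (fun j => b (i, j))) : MvPolynomial (PermIdx m n) ℂ))

theorem kills_of_bal {m n d : ℕ} {φ : (Ix d → Fin m) × (Ix d → Fin n) → ℂ} (h : WInv d φ)
    (hb : ∀ s, Bal d φ s) (F : MvPolynomial (PermIdx m n) ℂ →ₗ[ℂ] ℂ)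
    (hF : ∀ a b, F (mon d a b) = φ (a, b)) : ∀ f ∈ kerPsiBarDeg m n d, F f = 0 := by
  obtain ⟨ψ, hψ, hφ⟩ := exists_invariant (jK d) φ h.kb hb
  obtain ⟨G, hG⟩ := exists_functional (ι := Ix d)
    (fun w : Ix d → Fin m × Fin n => ψ (fun p => (w p).1, fun p => (w p).2))
    (fun s w => hψ s (fun p => (w p).1) (fun p => (w p).2))
  have key : ∀ f ∈ homogeneousSubmodule (PermIdx m n) ℂ d, F f = G (PsiBar m n f) := by
    intro f hf
    have hle : Submodule.span ℂ
        (Set.range fun p : (Ix d → Fin m) × (Ix d → Fin n) => mon d p.1 p.2) ≤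
        LinearMap.eqLocus F (G ∘ₗ (PsiBar m n).toLinearMap) := by
      rw [Submodule.span_le]
      rintro _ ⟨⟨a, b⟩, rfl⟩
      simp only [SetLike.mem_coe, LinearMap.mem_eqLocus, LinearMap.comp_apply,
        AlgHom.toLinearMap_apply, Psi_mon, map_sum, hF, hφ]
      refine Finset.sum_congr rfl fun k _ => ?_
      rw [hG]
    exact hle (mon_span d f hf)
  rintro f ⟨h1, h2⟩
  rw [key f h2]
  have : PsiBar m n f = 0 := h1
  rw [this, map_zero]

theorem rel_mem {m n d : ℕ} (s : Equiv.Perm (Ix d)) (a : Ix d → Fin m) (b : Ix d → Fin n) :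
    (∑ k, mon d (a ∘ (jK d k * s : Equiv.Perm (Ix d))) b -
      ∑ k, mon d a (b ∘ (jK d k * s⁻¹ : Equiv.Perm (Ix d)))) ∈ kerPsiBarDeg m n d := by
  refine ⟨?_, Submodule.sub_mem _ (Submodule.sum_mem _ fun _ _ => mon_homog _ _ _)
    (Submodule.sum_mem _ fun _ _ => mon_homog _ _ _)⟩
  change PsiBar m n _ = 0
  simp only [map_sub, map_sum, Psi_mon]
  rw [sub_eq_zero, Finset.sum_comm]
  refine Finset.sum_congr rfl fun k _ => ?_
  rw [← Equiv.sum_comp (Equiv.inv _)]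
  refine Finset.sum_congr rfl fun k' _ => ?_
  rw [← Equiv.prod_comp (s⁻¹ * jK d k' : Equiv.Perm (Ix d))]
  refine Finset.prod_congr rfl fun p _ => ?_
  simp only [Function.comp_apply]
  have h1 : (jK d ((Equiv.inv _) k') * s : Equiv.Perm (Ix d)) ((s⁻¹ * jK d k' : Equiv.Perm (Ix d)) p)
      = p := by
    rw [← Equiv.Perm.mul_apply]
    have : jK d ((Equiv.inv _) k') * s * (s⁻¹ * jK d k') = 1 := by
      simp [Equiv.inv_apply, map_inv]
    rw [this]
    rfl
  rw [h1]
  rfl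

theorem bal_of_kills {m n d : ℕ} (F : MvPolynomial (PermIdx m n) ℂ →ₗ[ℂ] ℂ)
    (hF : ∀ f ∈ kerPsiBarDeg m n d, F f = 0) (s : Equiv.Perm (Ix d)) :
    Bal d (fun p : (Ix d → Fin m) × (Ix d → Fin n) => F (mon d p.1 p.2)) s := by
  intro a b
  have := hF _ (rel_mem s a b)
  rw [map_sub, map_sum, map_sum, sub_eq_zero] at this
  exact this


theorem tS_jK {d : ℕ} (τ : Equiv.Perm (Fin d)) (κ : Fin d → Equiv.Perm (Fin 2)) :
    tS d τ * jK d κ = jK d (κ ∘ (τ⁻¹ : Equiv.Perm (Fin d))) * tS d τ := by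
  ext p <;> simp

/-- Reindexing of the block-inner group by a permutation of blocks. -/
def kre {d : ℕ} (τ : Equiv.Perm (Fin d)) :
    (Fin d → Equiv.Perm (Fin 2)) ≃ (Fin d → Equiv.Perm (Fin 2)) :=
  Equiv.arrowCongr τ (Equiv.refl _)

theorem tS_jK' {d : ℕ} (τ : Equiv.Perm (Fin d)) (κ : Fin d → Equiv.Perm (Fin 2)) :
    tS d τ * jK d κ = jK d (kre τ κ) * tS d τ := by
  ext p <;> simp [kre]

section closure
variable {m n d : ℕ} {φ : (Ix d → Fin m) × (Ix d → Fin n) → ℂ}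

theorem bal_right_j (h : WInv d φ) {s : Equiv.Perm (Ix d)} (κ) (hs : Bal d φ s) :
    Bal d φ (s * jK d κ) := by
  intro a b
  have h1 : ∀ k, φ (a ∘ (jK d k * (s * jK d κ) : Equiv.Perm (Ix d)), b) =
      φ (a ∘ (jK d k * s : Equiv.Perm (Ix d)), b) := fun k => by
    rw [← h.ka κ (a ∘ (jK d k * s : Equiv.Perm (Ix d))) b]; rfl
  simp only [h1]
  rw [hs a b, ← Equiv.sum_comp (Equiv.mulRight κ⁻¹)]
  refine Finset.sum_congr rfl fun k _ => ?_
  simp [mul_assoc]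

theorem bal_left_j (h : WInv d φ) {s : Equiv.Perm (Ix d)} (κ) (hs : Bal d φ s) :
    Bal d φ (jK d κ * s) := by
  intro a b
  have h1 : ∀ k, φ (a, b ∘ (jK d k * (jK d κ * s)⁻¹ : Equiv.Perm (Ix d))) =
      φ (a, b ∘ (jK d k * s⁻¹ : Equiv.Perm (Ix d))) := fun k => by
    rw [← h.kb κ⁻¹ a (b ∘ (jK d k * s⁻¹ : Equiv.Perm (Ix d)))]
    congr 2
  simp only [h1]
  rw [← hs a b]
  conv_rhs => rw [← Equiv.sum_comp (Equiv.mulRight κ)]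
  refine Finset.sum_congr rfl fun k _ => ?_
  rw [Equiv.coe_mulRight, map_mul, mul_assoc]

theorem winv_t' (h : WInv d φ) (τ : Equiv.Perm (Fin d)) (a b) :
    φ (a ∘ tS d τ, b) = φ (a, b ∘ ((tS d τ)⁻¹ : Equiv.Perm (Ix d))) := by
  rw [← h.t τ a (b ∘ ((tS d τ)⁻¹ : Equiv.Perm (Ix d)))]
  congr 2
  rw [Function.comp_assoc, ← Equiv.Perm.coe_mul, inv_mul_cancel]
  rfl

theorem bal_right_t (h : WInv d φ) {s : Equiv.Perm (Ix d)} (τ) (hs : Bal d φ s) :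
    Bal d φ (s * tS d τ) := by
  intro a b
  have h1 : ∀ k, φ (a ∘ (jK d k * (s * tS d τ) : Equiv.Perm (Ix d)), b) =
      φ (a ∘ (jK d k * s : Equiv.Perm (Ix d)), b ∘ ((tS d τ)⁻¹ : Equiv.Perm (Ix d))) := fun k =>
    winv_t' h τ (a ∘ (jK d k * s : Equiv.Perm (Ix d))) b
  simp only [h1]
  rw [hs]
  conv_rhs => rw [← Equiv.sum_comp (kre (τ⁻¹))]
  refine Finset.sum_congr rfl fun k _ => ?_
  rw [mul_inv_rev, ← mul_assoc, ← map_inv, ← tS_jK', Function.comp_assoc, ← Equiv.Perm.coe_mul,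
    mul_assoc]

theorem bal_left_t (h : WInv d φ) {s : Equiv.Perm (Ix d)} (τ) (hs : Bal d φ s) :
    Bal d φ (tS d τ * s) := by
  intro a b
  have h1 : ∀ k, φ (a, b ∘ (jK d k * (tS d τ * s)⁻¹ : Equiv.Perm (Ix d))) =
      φ (a ∘ tS d τ, b ∘ (jK d k * s⁻¹ : Equiv.Perm (Ix d))) := fun k => by
    rw [winv_t' h τ, Function.comp_assoc, mul_inv_rev, ← mul_assoc]; rfl
  simp only [h1]
  rw [← hs (a ∘ tS d τ) b]
  rw [← Equiv.sum_comp (kre τ)]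
  refine Finset.sum_congr rfl fun k _ => ?_
  rw [← mul_assoc, ← tS_jK', mul_assoc]; rfl

theorem bal_one (h : WInv d φ) : Bal d φ 1 := by
  intro a b
  simp [h.ka, h.kb]

end closure

/-- The exchange permutation in degree two. -/
def x2 : Equiv.Perm (Ix 2) := Equiv.swap (0, 1) (1, 0)
/-- The exchange permutation of blocks 1, 2 in degree three. -/
def x3 : Equiv.Perm (Ix 3) := Equiv.swap (1, 1) (2, 0)

set_option maxRecDepth 100000 in
theorem coset2 : ∀ s : Equiv.Perm (Ix 2), ∃ κ κ' τ, s = jK 2 κ * tS 2 τ ∨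
    s = jK 2 κ * x2 * jK 2 κ' := by
  decide +kernel

theorem bal2_all {m n : ℕ} {φ : (Ix 2 → Fin m) × (Ix 2 → Fin n) → ℂ} (h : WInv 2 φ)
    (hx : Bal 2 φ x2) (s) : Bal 2 φ s := by
  obtain ⟨κ, κ', τ, rfl | rfl⟩ := coset2 s
  · refine bal_left_j h _ ?_
    rw [← mul_one (tS 2 τ)]
    exact bal_left_t h _ (bal_one h)
  · exact bal_right_j h _ (bal_left_j h _ hx)

/-- Prepend a block to a word. -/
def ext3 {m : ℕ} (u : Fin 2 → Fin m) (a : Ix 2 → Fin m) : Ix 3 → Fin m :=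
  fun p => (Fin.cons (u p.2) (fun i => a (i, p.2)) : Fin 3 → Fin m) p.1

@[simp] theorem ext3_zero {m : ℕ} (u : Fin 2 → Fin m) (a : Ix 2 → Fin m) (j) :
    ext3 u a (0, j) = u j := rfl
@[simp] theorem ext3_succ {m : ℕ} (u : Fin 2 → Fin m) (a : Ix 2 → Fin m) (i : Fin 2) (j) :
    ext3 u a (i.succ, j) = a (i, j) := rfl

theorem ext3_surj {m : ℕ} (a : Ix 3 → Fin m) :
    a = ext3 (fun j => a (0, j)) (fun p => a (p.1.succ, p.2)) := by
  ext ⟨i, j⟩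
  refine Fin.cases ?_ (fun i => ?_) i <;> simp

theorem mon_ext3 {m n : ℕ} (u : Fin 2 → Fin m) (v : Fin 2 → Fin n) (a b) :
    mon 3 (ext3 u a) (ext3 v b) = X (qd u v) * mon 2 a b := by
  rw [mon, Fin.prod_univ_succ]; rfl

theorem x3_zero (j) : x3 (0, j) = (0, j) := by revert j; decide
theorem x3_succ (i : Fin 2) (j) : x3 (i.succ, j) = ((x2 (i, j)).1.succ, (x2 (i, j)).2) := by
  revert i j; decide

theorem ext3_comp {m : ℕ} (u : Fin 2 → Fin m) (a : Ix 2 → Fin m) (κ₀ : Equiv.Perm (Fin 2))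
    (κ : Fin 2 → Equiv.Perm (Fin 2)) :
    ext3 u a ∘ (jK 3 (Fin.cons κ₀ κ) * x3 : Equiv.Perm (Ix 3)) =
      ext3 (u ∘ κ₀) (a ∘ (jK 2 κ * x2 : Equiv.Perm (Ix 2))) := by
  ext ⟨i, j⟩
  refine Fin.cases ?_ (fun i => ?_) i
  · simp [x3_zero]
  · simp [x3_succ]

theorem ext3_comp_j {m : ℕ} (u : Fin 2 → Fin m) (a : Ix 2 → Fin m) (κ₀ : Equiv.Perm (Fin 2))
    (κ : Fin 2 → Equiv.Perm (Fin 2)) :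
    ext3 u a ∘ (jK 3 (Fin.cons κ₀ κ) : Equiv.Perm (Ix 3)) =
      ext3 (u ∘ κ₀) (a ∘ (jK 2 κ : Equiv.Perm (Ix 2))) := by
  ext ⟨i, j⟩
  refine Fin.cases ?_ (fun i => ?_) i
  · simp
  · simp

theorem ext3_comp_t {m : ℕ} (u : Fin 2 → Fin m) (a : Ix 2 → Fin m) (τ : Equiv.Perm (Fin 2)) :
    ext3 u a ∘ (tS 3 (Equiv.Perm.decomposeFin.symm (0, τ)) : Equiv.Perm (Ix 3)) =
      ext3 u (a ∘ (tS 2 τ : Equiv.Perm (Ix 2))) := by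
  ext ⟨i, j⟩
  refine Fin.cases ?_ (fun i => ?_) i
  · simp
  · simp

theorem winv_ext {m n : ℕ} {φ : (Ix 3 → Fin m) × (Ix 3 → Fin n) → ℂ} (h : WInv 3 φ) (u v) :
    WInv 2 (fun p => φ (ext3 u p.1, ext3 v p.2)) := by
  constructor
  · intro κ a b
    have := h.ka (Fin.cons 1 κ) (ext3 u a) (ext3 v b)
    rwa [ext3_comp_j] at this
  · intro κ a b
    have := h.kb (Fin.cons 1 κ) (ext3 u a) (ext3 v b)
    rwa [ext3_comp_j] at this
  · intro τ a b
    have := h.t (Equiv.Perm.decomposeFin.symm (0, τ)) (ext3 u a) (ext3 v b)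
    rwa [ext3_comp_t, ext3_comp_t] at this

theorem ext_u {m n : ℕ} {φ : (Ix 3 → Fin m) × (Ix 3 → Fin n) → ℂ} (h : WInv 3 φ) (u a b)
    (κ₀ : Equiv.Perm (Fin 2)) : φ (ext3 (u ∘ κ₀) a, b) = φ (ext3 u a, b) := by
  have := h.ka (Fin.cons κ₀ 1) (ext3 u a) b
  rw [ext3_comp_j] at this
  simpa using this

theorem ext_v {m n : ℕ} {φ : (Ix 3 → Fin m) × (Ix 3 → Fin n) → ℂ} (h : WInv 3 φ) (u a b)
    (κ₀ : Equiv.Perm (Fin 2)) : φ (a, ext3 (u ∘ κ₀) b) = φ (a, ext3 u b) := by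
  have := h.kb (Fin.cons κ₀ 1) a (ext3 u b)
  rw [ext3_comp_j] at this
  simpa using this

theorem sum_kappa3 (F : (Fin 3 → Equiv.Perm (Fin 2)) → ℂ) :
    ∑ κ, F κ = ∑ κ₀, ∑ κ, F (Fin.cons κ₀ κ) := by
  rw [← Equiv.sum_comp (Fin.consEquiv fun _ => Equiv.Perm (Fin 2)), Fintype.sum_prod_type]
  rfl

theorem x3_inv : x3⁻¹ = x3 := by simp [x3]
theorem x2_inv : x2⁻¹ = x2 := by simp [x2]

theorem bal_ext_iff {m n : ℕ} {φ : (Ix 3 → Fin m) × (Ix 3 → Fin n) → ℂ} (h : WInv 3 φ) :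
    Bal 3 φ x3 ↔ ∀ u v, Bal 2 (fun p => φ (ext3 u p.1, ext3 v p.2)) x2 := by
  have key : ∀ u v a b, (∑ k, φ (ext3 u a ∘ (jK 3 k * x3 : Equiv.Perm (Ix 3)), ext3 v b) =
      ∑ k, φ (ext3 u a, ext3 v b ∘ (jK 3 k * x3⁻¹ : Equiv.Perm (Ix 3)))) ↔
      (∑ k, φ (ext3 u (a ∘ (jK 2 k * x2 : Equiv.Perm (Ix 2))), ext3 v b) =
      ∑ k, φ (ext3 u a, ext3 v (b ∘ (jK 2 k * x2⁻¹ : Equiv.Perm (Ix 2))))) := by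
    intro u v a b
    rw [sum_kappa3, sum_kappa3, x3_inv, x2_inv]
    simp only [ext3_comp, ext_u h, ext_v h]
    simp
  constructor
  · intro hb u v a b
    exact (key u v a b).1 (hb _ _)
  · intro hb a b
    rw [ext3_surj a, ext3_surj b, key]
    exact hb (fun j => a (0, j)) (fun j => b (0, j)) (fun p => a (p.1.succ, p.2))
      (fun p => b (p.1.succ, p.2))

/-- Functionals killing `R₁ ker₂` are those that are balanced at `x3`. -/
theorem kills_Q_iff {m n : ℕ} (F : MvPolynomial (PermIdx m n) ℂ →ₗ[ℂ] ℂ) :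
    (∀ f ∈ R1kerPsiBar2 m n, F f = 0) ↔
      Bal 3 (fun p : (Ix 3 → Fin m) × (Ix 3 → Fin n) => F (mon 3 p.1 p.2)) x3 := by
  have hmul : ∀ w : PermIdx m n, ∀ u v, w = qd u v → ∀ a b,
      (F ∘ₗ LinearMap.mulLeft ℂ (X w)) (mon 2 a b) = F (mon 3 (ext3 u a) (ext3 v b)) := by
    rintro w u v rfl a b
    rw [mon_ext3]; rfl
  rw [bal_ext_iff (inv_of_F F)]
  constructor
  · intro h u v
    have h1 := bal_of_kills (d := 2) (F ∘ₗ LinearMap.mulLeft ℂ (X (qd u v))) (fun f hf =>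
      h _ (Submodule.subset_span ⟨_, f, hf, rfl⟩)) x2
    simpa only [hmul (qd u v) u v rfl] using h1
  · intro h f hf
    have hle : R1kerPsiBar2 m n ≤ LinearMap.ker F := by
      refine Submodule.span_le.2 ?_
      rintro _ ⟨w, q, hq, rfl⟩
      have hw := qd_wuv w
      exact kills_of_bal (winv_ext (inv_of_F F) (wu w) (wv w))
        (bal2_all (winv_ext (inv_of_F F) (wu w) (wv w)) (h (wu w) (wv w)))
        (F ∘ₗ LinearMap.mulLeft ℂ (X w)) (fun a b => hmul w _ _ hw.symm a b) q hq
    exact hle hf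


/-- Involution representing the hexagonal double coset. -/
def g2 : Equiv.Perm (Ix 3) :=
  Equiv.swap (0, 0) (1, 0) * Equiv.swap (0, 1) (2, 0) * Equiv.swap (1, 1) (2, 1)
/-- The exchange permutation of blocks 0, 1 in degree three. -/
def g1 : Equiv.Perm (Ix 3) := Equiv.swap (0, 1) (1, 0)
/-- A translate of `x3`. -/
def y3 : Equiv.Perm (Ix 3) := x3 * tS 3 (Equiv.swap 0 2)

theorem g1_inv : g1⁻¹ = g1 := by simp [g1]
theorem g2_inv : g2⁻¹ = g2 := by decide +kernel

theorem W2 : ∃ τ τ', tS 3 τ * x3 * tS 3 τ' = g1 := by decide +kernel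
theorem W1g : ∃ κ τ, Equiv.Perm.sign τ = -1 ∧ g1 * tS 3 τ = jK 3 κ * g1 := by decide +kernel
theorem W1x : ∃ κ τ, Equiv.Perm.sign τ = -1 ∧ x3 * tS 3 τ = jK 3 κ * x3 := by decide +kernel
theorem W4 : ∀ τ, ∃ κ, tS 3 τ * g2 * tS 3 τ⁻¹ = jK 3 κ * g2 * jK 3 κ := by decide +kernel
theorem W3 : ∀ κ : Fin 3 → Equiv.Perm (Fin 2), ∃ κ1 κ2, g1 * jK 3 κ * y3 =
    jK 3 κ1 * (g2 * tS 3 (if κ 1 = 1 then 1 else Equiv.swap 0 1)) * jK 3 κ2 := by decide +kernel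

/-- The standard nontrivial element of `Perm (Fin 2)`. -/
abbrev sw2 : Equiv.Perm (Fin 2) := Equiv.swap 0 1

theorem sum8 {M : Type*} [AddCommMonoid M] (F : (Fin 3 → Equiv.Perm (Fin 2)) → M) :
    ∑ κ, F κ = F ![1, 1, 1] + F ![1, 1, sw2] + (F ![1, sw2, 1] + F ![1, sw2, sw2]) +
      (F ![sw2, 1, 1] + F ![sw2, 1, sw2] + (F ![sw2, sw2, 1] + F ![sw2, sw2, sw2])) := by
  have h : ∀ (d : ℕ) (G : (Fin (d + 1) → Equiv.Perm (Fin 2)) → M),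
      ∑ κ, G κ = ∑ κ₀, ∑ κ, G (Matrix.vecCons κ₀ κ) := by
    intro d G
    rw [← Equiv.sum_comp (Fin.consEquiv fun _ => Equiv.Perm (Fin 2)), Fintype.sum_prod_type]
    rfl
  simp only [h, sum_perm2]
  simp [Matrix.empty_eq]

/-- The group algebra in degree three. -/
abbrev GA := MonoidAlgebra ℂ (Equiv.Perm (Ix 3))

noncomputable def oo (σ : Equiv.Perm (Ix 3)) : GA := MonoidAlgebra.of ℂ _ σ

theorem oo_mul (σ τ) : oo (σ * τ) = oo σ * oo τ := by simp [oo]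
theorem oo_one : oo 1 = 1 := by simp [oo, MonoidAlgebra.one_def]

/-- sign as a complex number -/
noncomputable def sg (τ : Equiv.Perm (Fin 3)) : ℂ := ((Equiv.Perm.sign τ : ℤ) : ℂ)

theorem sg_mul (σ τ) : sg (σ * τ) = sg σ * sg τ := by simp [sg]
theorem sg_sq (τ) : sg τ * sg τ = 1 := by
  rcases Int.units_eq_one_or (Equiv.Perm.sign τ) with h | h <;> simp [sg, h]
theorem sg_inv (τ) : sg τ⁻¹ = sg τ := by simp [sg]
theorem sg_neg {τ} (h : Equiv.Perm.sign τ = -1) : sg τ = -1 := by simp [sg, h]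

noncomputable def eK : GA := (1 / 8 : ℂ) • ∑ κ, oo (jK 3 κ)
noncomputable def eS : GA := (1 / 6 : ℂ) • ∑ τ, sg τ • oo (tS 3 τ)
noncomputable def ee : GA := eK * eS

theorem card8 : Fintype.card (Fin 3 → Equiv.Perm (Fin 2)) = 8 := by
  simp [Fintype.card_perm]
theorem card6 : Fintype.card (Equiv.Perm (Fin 3)) = 6 := by
  simp [Fintype.card_perm, Nat.factorial]

theorem j_eK (κ) : oo (jK 3 κ) * eK = eK := by
  rw [eK, mul_smul_comm, Finset.mul_sum]
  congr 1
  conv_rhs => rw [← Equiv.sum_comp (Equiv.mulLeft κ)]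
  exact Finset.sum_congr rfl fun k _ => by rw [Equiv.coe_mulLeft, map_mul, oo_mul]

theorem eK_j (κ) : eK * oo (jK 3 κ) = eK := by
  rw [eK, smul_mul_assoc, Finset.sum_mul]
  congr 1
  conv_rhs => rw [← Equiv.sum_comp (Equiv.mulRight κ)]
  exact Finset.sum_congr rfl fun k _ => by rw [Equiv.coe_mulRight, map_mul, oo_mul]

theorem t_eK (τ) : oo (tS 3 τ) * eK = eK * oo (tS 3 τ) := by
  rw [eK, mul_smul_comm, smul_mul_assoc, Finset.mul_sum, Finset.sum_mul]
  congr 1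
  conv_rhs => rw [← Equiv.sum_comp (kre τ)]
  exact Finset.sum_congr rfl fun k _ => by rw [← oo_mul, tS_jK', oo_mul]

theorem t_eS (τ) : oo (tS 3 τ) * eS = sg τ • eS := by
  rw [eS, mul_smul_comm, Finset.mul_sum, smul_comm, Finset.smul_sum (r := sg τ)]
  congr 1
  conv_rhs => rw [← Equiv.sum_comp (Equiv.mulLeft τ)]
  refine Finset.sum_congr rfl fun k _ => ?_
  rw [Equiv.coe_mulLeft, map_mul, oo_mul, sg_mul, smul_smul, ← mul_assoc, sg_sq, one_mul,
    mul_smul_comm]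

theorem eS_t (τ) : eS * oo (tS 3 τ) = sg τ • eS := by
  rw [eS, smul_mul_assoc, Finset.sum_mul, smul_comm, Finset.smul_sum (r := sg τ)]
  congr 1
  conv_rhs => rw [← Equiv.sum_comp (Equiv.mulRight τ)]
  refine Finset.sum_congr rfl fun k _ => ?_
  rw [Equiv.coe_mulRight, map_mul, oo_mul, sg_mul, smul_smul, mul_left_comm, sg_sq, mul_one,
    smul_mul_assoc]

theorem eS_eK : eS * eK = eK * eS := by
  rw [eS, mul_smul_comm, smul_mul_assoc, Finset.mul_sum, Finset.sum_mul]
  congr 1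
  exact Finset.sum_congr rfl fun k _ => by rw [smul_mul_assoc, mul_smul_comm, t_eK]

theorem eK_eK : eK * eK = eK := by
  conv_lhs => rw [eK]
  rw [smul_mul_assoc, Finset.sum_mul]
  simp only [← eK.eq_def, j_eK]
  rw [Finset.sum_const, Finset.card_univ, card8, ← Nat.cast_smul_eq_nsmul ℂ, smul_smul]
  norm_num

theorem eS_eS : eS * eS = eS := by
  conv_lhs => rw [eS]
  rw [smul_mul_assoc, Finset.sum_mul]
  simp only [← eS.eq_def, smul_mul_assoc, t_eS, smul_smul, sg_sq]
  rw [← Finset.smul_sum.symm]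
  simp only [one_smul, Finset.sum_const, Finset.card_univ, card6]
  rw [← Nat.cast_smul_eq_nsmul ℂ, smul_smul]
  norm_num

theorem eK_ee : eK * ee = ee := by rw [ee, ← mul_assoc, eK_eK]
theorem ee_eK : ee * eK = ee := by rw [ee, mul_assoc, eS_eK, ← mul_assoc, eK_eK]
theorem eS_ee : eS * ee = ee := by rw [ee, ← mul_assoc, eS_eK, mul_assoc, eS_eS]
theorem ee_eS : ee * eS = ee := by rw [ee, mul_assoc, eS_eS]
theorem ee_ee : ee * ee = ee := by nth_rewrite 1 [ee]; rw [mul_assoc, eS_ee, eK_ee]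
theorem j_ee (κ) : oo (jK 3 κ) * ee = ee := by rw [ee, ← mul_assoc, j_eK]
theorem ee_j (κ) : ee * oo (jK 3 κ) = ee := by rw [ee, ← eS_eK, mul_assoc, eK_j]
theorem t_ee (τ) : oo (tS 3 τ) * ee = sg τ • ee := by
  rw [ee, ← mul_assoc, t_eK, mul_assoc, t_eS, mul_smul_comm]
theorem ee_t (τ) : ee * oo (tS 3 τ) = sg τ • ee := by
  rw [ee, mul_assoc, eS_t, mul_smul_comm]


theorem eK_zero {c : Equiv.Perm (Ix 3)}
    (h : ∃ κ τ, Equiv.Perm.sign τ = -1 ∧ c * tS 3 τ = jK 3 κ * c) : eK * oo c * ee = 0 := by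
  obtain ⟨κ, τ, hs, h⟩ := h
  have h1 : eK * oo c * ee = -(eK * oo c * ee) := by
    calc eK * oo c * ee = eK * oo (jK 3 κ * c) * ee := by
          rw [oo_mul, ← mul_assoc, eK_j]
      _ = -(eK * oo c * ee) := by
          rw [← h, oo_mul, ← mul_assoc, mul_assoc _ _ ee, t_ee, sg_neg hs, neg_one_smul, mul_neg]
  have h2 : (2 : ℂ) • (eK * oo c * ee) = 0 := by
    rw [two_smul]; nth_rewrite 1 [h1]; exact neg_add_cancel _
  exact (smul_eq_zero.1 h2).resolve_left two_ne_zero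

theorem eK_g1_ee : eK * oo g1 * ee = 0 := eK_zero W1g
theorem eK_x3_ee : eK * oo x3 * ee = 0 := eK_zero W1x
theorem ee_g1_ee : ee * oo g1 * ee = 0 := by
  nth_rewrite 1 [ee]
  rw [← eS_eK, mul_assoc eS, mul_assoc eS, eK_g1_ee, mul_zero]

noncomputable def TT : GA := ee * oo g2 * ee

theorem eS_mul_of (x : GA) (h : ∀ τ, oo (tS 3 τ) * x = sg τ • x) : eS * x = x := by
  rw [eS, smul_mul_assoc, Finset.sum_mul]
  simp only [smul_mul_assoc, h, smul_smul, sg_sq]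
  simp only [one_smul, Finset.sum_const, Finset.card_univ, card6]
  rw [← Nat.cast_smul_eq_nsmul ℂ, smul_smul]
  norm_num

theorem mul_eS_of (x : GA) (h : ∀ τ, x * oo (tS 3 τ) = sg τ • x) : x * eS = x := by
  rw [eS, mul_smul_comm, Finset.mul_sum]
  simp only [mul_smul_comm, h, smul_smul, sg_sq]
  simp only [one_smul, Finset.sum_const, Finset.card_univ, card6]
  rw [← Nat.cast_smul_eq_nsmul ℂ, smul_smul]
  norm_num

/-- Conjugating the bi-invariant element by block permutations. -/
theorem t_g2 (τ) : oo (tS 3 τ) * (eK * oo g2 * eK) = eK * oo g2 * eK * oo (tS 3 τ) := by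
  obtain ⟨κ, h⟩ := W4 τ
  have h2 : tS 3 τ * g2 = jK 3 κ * g2 * jK 3 κ * tS 3 τ := by
    rw [← h, mul_assoc _ (tS 3 τ⁻¹), ← map_mul, inv_mul_cancel, map_one, mul_one]
  calc oo (tS 3 τ) * (eK * oo g2 * eK) = eK * oo (tS 3 τ * g2) * eK := by
        rw [oo_mul, ← mul_assoc, ← mul_assoc, t_eK, mul_assoc eK]
    _ = eK * oo g2 * eK * oo (tS 3 τ) := by
        rw [h2, oo_mul, oo_mul, oo_mul, ← mul_assoc, ← mul_assoc, ← mul_assoc, eK_j,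
          mul_assoc _ (oo (tS 3 τ)), t_eK, ← mul_assoc, mul_assoc _ (oo (jK 3 κ)), j_eK]

theorem T_left : TT = eK * oo g2 * ee := by
  have h : eK * oo g2 * ee = (eK * oo g2 * eK) * ee := by rw [mul_assoc _ eK, eK_ee]
  have h2 : TT = eS * (eK * oo g2 * ee) := by
    rw [TT]; nth_rewrite 1 [ee]
    rw [← eS_eK]; simp only [mul_assoc]
  rw [h2]
  refine eS_mul_of _ fun τ => ?_
  rw [h, ← mul_assoc, t_g2, mul_assoc, t_ee, mul_smul_comm]

theorem T_right : TT = ee * oo g2 * eK := by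
  have h : ee * oo g2 * eK = ee * (eK * oo g2 * eK) := by
    rw [← mul_assoc, ← mul_assoc, ee_eK]
  have h2 : TT = (ee * oo g2 * eK) * eS := by
    rw [TT]; nth_rewrite 2 [ee]
    simp only [mul_assoc]
  rw [h2]
  refine mul_eS_of _ fun τ => ?_
  rw [h, mul_assoc, ← t_g2, ← mul_assoc, ee_t, smul_mul_assoc]

theorem ece {c c' : Equiv.Perm (Ix 3)} (κ τ τ' κ')
    (h : c' = jK 3 κ * tS 3 τ * c * (tS 3 τ' * jK 3 κ')) :
    ee * oo c' * ee = (sg τ * sg τ') • (ee * oo c * ee) := by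
  subst h
  have : ee * oo (jK 3 κ * tS 3 τ * c * (tS 3 τ' * jK 3 κ')) * ee =
      ((ee * oo (jK 3 κ)) * oo (tS 3 τ)) * oo c * (oo (tS 3 τ') * (oo (jK 3 κ') * ee)) := by
    simp only [oo_mul, mul_assoc]
  rw [this, ee_j, j_ee, ee_t, t_ee]
  simp only [smul_mul_assoc, mul_smul_comm, smul_smul]
  rw [mul_comm]

theorem sg_one : sg 1 = 1 := by simp [sg]
theorem sg_swap {i j : Fin 3} (h : i ≠ j) : sg (Equiv.swap i j) = -1 :=
  sg_neg (Equiv.Perm.sign_swap h)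

theorem T_sq : TT * TT = (1 / 8 : ℂ) • ee - (1 / 4 : ℂ) • TT := by
  have h1 : TT * TT = (1 / 8 : ℂ) • ∑ κ, ee * oo (g2 * jK 3 κ * g2) * ee := by
    nth_rewrite 1 [T_right]
    rw [T_left]
    have : ee * oo g2 * eK * (eK * oo g2 * ee) = ee * oo g2 * (eK * eK) * oo g2 * ee := by
      simp only [mul_assoc]
    rw [this, eK_eK, eK]
    simp only [oo_mul, mul_smul_comm, smul_mul_assoc, Finset.mul_sum, Finset.sum_mul, mul_assoc]
  have a01 : (0 : Fin 3) ≠ 1 := by decide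
  have a12 : (1 : Fin 3) ≠ 2 := by decide
  have a02 : (0 : Fin 3) ≠ 2 := by decide
  rw [h1, sum8]
  rw [ece (c := 1) (c' := g2 * jK 3 ![1, 1, 1] * g2) 1 1 1 1 (by decide +kernel),
    ece (c := g1) (c' := g2 * jK 3 ![1, 1, sw2] * g2) ![1, sw2, 1] 1 1 ![1, sw2, 1]
      (by decide +kernel),
    ece (c := g1) (c' := g2 * jK 3 ![1, sw2, 1] * g2) 1 (Equiv.swap 1 2)
      (Equiv.swap 0 1 * Equiv.swap 1 2) ![sw2, 1, sw2] (by decide +kernel),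
    ece (c := g2) (c' := g2 * jK 3 ![1, sw2, sw2] * g2) 1 (Equiv.swap 0 1 * Equiv.swap 1 2)
      (Equiv.swap 0 2) ![sw2, 1, 1] (by decide +kernel),
    ece (c := g1) (c' := g2 * jK 3 ![sw2, 1, 1] * g2) ![1, 1, sw2]
      (Equiv.swap 0 1 * Equiv.swap 1 2) (Equiv.swap 0 2) ![1, sw2, 1] (by decide +kernel),
    ece (c := g2) (c' := g2 * jK 3 ![sw2, 1, sw2] * g2) ![1, 1, sw2] (Equiv.swap 1 2)
      (Equiv.swap 0 1 * Equiv.swap 1 2) ![1, sw2, sw2] (by decide +kernel),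
    ece (c := g2) (c' := g2 * jK 3 ![sw2, sw2, 1] * g2) 1 (Equiv.swap 1 2 * Equiv.swap 0 1)
      (Equiv.swap 0 2) ![1, 1, sw2] (by decide +kernel),
    ece (c := g2) (c' := g2 * jK 3 ![sw2, sw2, sw2] * g2) 1 (Equiv.swap 0 2)
      (Equiv.swap 0 2) 1 (by decide +kernel)]
  simp only [sg_mul, sg_one, sg_swap a01, sg_swap a12, sg_swap a02, ee_g1_ee, ← TT.eq_def, oo_one,
    mul_one, ee_ee]
  module

noncomputable def e1 : GA := (1 / 3 : ℂ) • ((4 : ℂ) • TT + (2 : ℂ) • ee)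
noncomputable def e2 : GA := (1 / 3 : ℂ) • (ee - (4 : ℂ) • TT)

theorem ee_T : ee * TT = TT := by rw [TT, ← mul_assoc, ← mul_assoc, ee_ee]
theorem T_ee : TT * ee = TT := by rw [TT, mul_assoc, ee_ee]
theorem e1_add_e2 : e1 + e2 = ee := by rw [e1, e2]; module
theorem T_eq : TT = (1 / 4 : ℂ) • e1 - (1 / 2 : ℂ) • e2 := by rw [e1, e2]; module
theorem ee_e1 : ee * e1 = e1 := by
  simp only [e1, mul_smul_comm, mul_add, ee_T, ee_ee]
theorem ee_e2 : ee * e2 = e2 := by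
  simp only [e2, mul_smul_comm, mul_sub, ee_T, ee_ee]
theorem e1_ee : e1 * ee = e1 := by
  simp only [e1, smul_mul_assoc, add_mul, T_ee, ee_ee]
theorem e2_ee : e2 * ee = e2 := by
  simp only [e2, smul_mul_assoc, sub_mul, T_ee, ee_ee]
theorem e1_e1 : e1 * e1 = e1 := by
  simp only [e1, smul_mul_assoc, add_mul, mul_smul_comm, mul_add, ee_T, T_ee, ee_ee, T_sq]
  module
theorem e1_e2 : e1 * e2 = 0 := by
  simp only [e1, e2, smul_mul_assoc, add_mul, mul_smul_comm, mul_sub, ee_T, T_ee, ee_ee, T_sq]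
  module
theorem e2_e1 : e2 * e1 = 0 := by
  simp only [e1, e2, smul_mul_assoc, sub_mul, mul_smul_comm, mul_add, ee_T, T_ee, ee_ee, T_sq]
  module
theorem e2_e2 : e2 * e2 = e2 := by
  simp only [e2, smul_mul_assoc, sub_mul, mul_smul_comm, mul_sub, ee_T, T_ee, ee_ee, T_sq]
  module


theorem W3i : ∀ κ : Fin 3 → Equiv.Perm (Fin 2), ∃ κ1 κ2, y3⁻¹ * jK 3 κ * g1 =
    jK 3 κ1 * (tS 3 (if κ 1 = 1 then 1 else Equiv.swap 0 1) * g2) * jK 3 κ2 := by decide +kernel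

theorem eK_double {c c'} (h : ∃ κ1 κ2, c = jK 3 κ1 * c' * jK 3 κ2) :
    eK * oo c * eK = eK * oo c' * eK := by
  obtain ⟨κ1, κ2, rfl⟩ := h
  rw [oo_mul, oo_mul, ← mul_assoc, ← mul_assoc, eK_j, mul_assoc _ _ eK, j_eK]

theorem eK_exp (x y : Equiv.Perm (Ix 3)) : eK * oo x * eK * oo y * eK =
    (1 / 8 : ℂ) • ∑ κ, eK * oo (x * jK 3 κ * y) * eK := by
  have : eK * oo x * eK * oo y * eK = eK * oo x * ((1 / 8 : ℂ) • ∑ κ, oo (jK 3 κ)) * oo y * eK := by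
    rw [← eK.eq_def]
  rw [this]
  simp only [oo_mul, mul_smul_comm, smul_mul_assoc, Finset.mul_sum, Finset.sum_mul, mul_assoc]

theorem W3_alg : eK * oo g1 * eK * oo y3 * eK =
    (1 / 2 : ℂ) • (eK * oo g2 * eK + eK * oo (g2 * tS 3 (Equiv.swap 0 1)) * eK) := by
  rw [eK_exp]
  simp only [eK_double (W3 _)]
  rw [sum8]
  have : sw2 ≠ 1 := by decide
  simp [this]
  module

theorem W3i_alg : eK * oo y3⁻¹ * eK * oo g1 * eK =
    (1 / 2 : ℂ) • (eK * oo g2 * eK + eK * oo (tS 3 (Equiv.swap 0 1) * g2) * eK) := by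
  rw [eK_exp]
  simp only [eK_double (W3i _)]
  rw [sum8]
  have : sw2 ≠ 1 := by decide
  simp [this]
  module

section doublecoset

theorem perm_ext6 {s r : Equiv.Perm (Ix 3)} (h0 : s (0, 0) = r (0, 0)) (h1 : s (0, 1) = r (0, 1))
    (h2 : s (1, 0) = r (1, 0)) (h3 : s (1, 1) = r (1, 1)) (h4 : s (2, 0) = r (2, 0))
    (h5 : s (2, 1) = r (2, 1)) : s = r := by
  ext1 ⟨i, j⟩
  fin_cases i <;> fin_cases j <;> assumption

theorem D1 : ∀ p : Ix 3, ∃ κ τ, (jK 3 κ * tS 3 τ) p = (0, 0) := by decide +kernel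
theorem D2 : ∀ p : Ix 3, p ≠ (0, 0) → ∃ κ τ, (jK 3 κ * tS 3 τ) (0, 0) = (0, 0) ∧
    ((jK 3 κ * tS 3 τ) p = (0, 1) ∨ (jK 3 κ * tS 3 τ) p = (1, 0)) := by decide +kernel
theorem D3 : ∀ p : Ix 3, p ≠ (0, 0) → p ≠ (0, 1) → ∃ κ τ, (jK 3 κ * tS 3 τ) (0, 0) = (0, 0) ∧
    (jK 3 κ * tS 3 τ) (0, 1) = (0, 1) ∧ (jK 3 κ * tS 3 τ) p = (1, 0) := by decide +kernel
theorem D3' : ∀ p : Ix 3, p ≠ (0, 0) → p ≠ (0, 1) → ∃ κ τ, (jK 3 κ * tS 3 τ) (0, 0) = (0, 0) ∧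
    (jK 3 κ * tS 3 τ) (0, 1) = (0, 1) ∧ (jK 3 κ * tS 3 τ) (1, 0) = p := by decide +kernel
theorem D40 : ∀ p : Ix 3, (p ≠ (0, 0) ∧ p ≠ (0, 1) ∧ p ≠ (1, 0)) →
    p = (1, 1) ∨ p = (2, 0) ∨ p = (2, 1) := by decide

theorem D4 : ∀ p q r : Ix 3, p ≠ q → p ≠ r → q ≠ r → (p ≠ (0, 0) ∧ p ≠ (0, 1) ∧ p ≠ (1, 0)) →
    (q ≠ (0, 0) ∧ q ≠ (0, 1) ∧ q ≠ (1, 0)) → (r ≠ (0, 0) ∧ r ≠ (0, 1) ∧ r ≠ (1, 0)) →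
    (p = (1, 1) ∧ q = (2, 0) ∧ r = (2, 1)) ∨ (p = (1, 1) ∧ q = (2, 1) ∧ r = (2, 0)) ∨
    (p = (2, 0) ∧ q = (1, 1) ∧ r = (2, 1)) ∨ (p = (2, 0) ∧ q = (2, 1) ∧ r = (1, 1)) ∨
    (p = (2, 1) ∧ q = (1, 1) ∧ r = (2, 0)) ∨ (p = (2, 1) ∧ q = (2, 0) ∧ r = (1, 1)) := by
  intro p q r h1 h2 h3 hp hq hr
  rcases D40 p hp with rfl | rfl | rfl <;> rcases D40 q hq with rfl | rfl | rfl <;>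
    rcases D40 r hr with rfl | rfl | rfl <;> simp at h1 h2 h3 ⊢

/-- Swap inside the last block. -/
abbrev cc : Fin 3 → Equiv.Perm (Fin 2) := ![1, 1, sw2]

theorem D5 (s : Equiv.Perm (Ix 3)) (h0 : s (0, 0) = (0, 0)) (h1 : s (0, 1) = (0, 1))
    (h2 : s (1, 0) = (1, 0)) : s = 1 ∨ s = jK 3 cc ∨ s = x3 ∨ s = x3 * jK 3 cc ∨
      s = jK 3 cc * x3 ∨ s = jK 3 cc * x3 * jK 3 cc := by
  have key : ∀ p q : Ix 3, p ≠ q → s p ≠ s q := fun p q h => s.injective.ne h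
  have k (p : Ix 3) (n0 : p ≠ (0, 0)) (n1 : p ≠ (0, 1)) (n2 : p ≠ (1, 0)) :
      s p ≠ (0, 0) ∧ s p ≠ (0, 1) ∧ s p ≠ (1, 0) :=
    ⟨h0 ▸ key _ _ n0, fun h => key _ _ n1 (h.trans h1.symm), fun h => key _ _ n2 (h.trans h2.symm)⟩
  rcases D4 (s (1, 1)) (s (2, 0)) (s (2, 1)) (key _ _ (by decide)) (key _ _ (by decide))
    (key _ _ (by decide)) (k _ (by decide) (by decide) (by decide))
    (k _ (by decide) (by decide) (by decide)) (k _ (by decide) (by decide) (by decide))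
    with ⟨h3, h4, h5⟩ | ⟨h3, h4, h5⟩ | ⟨h3, h4, h5⟩ | ⟨h3, h4, h5⟩ | ⟨h3, h4, h5⟩ | ⟨h3, h4, h5⟩
  · left; apply perm_ext6 <;> simp only [h0, h1, h2, h3, h4, h5] <;> decide
  · right; left; apply perm_ext6 <;> simp only [h0, h1, h2, h3, h4, h5] <;> decide
  · right; right; left; apply perm_ext6 <;> simp only [h0, h1, h2, h3, h4, h5] <;> decide
  · right; right; right; left
    apply perm_ext6 <;> simp only [h0, h1, h2, h3, h4, h5] <;> decide
  · right; right; right; right; left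
    apply perm_ext6 <;> simp only [h0, h1, h2, h3, h4, h5] <;> decide
  · right; right; right; right; right
    apply perm_ext6 <;> simp only [h0, h1, h2, h3, h4, h5] <;> decide

theorem W6h : ∃ κ τ κ', g1 * x3 = jK 3 κ * (tS 3 τ * g2) * jK 3 κ' := by decide +kernel
theorem cg1 : jK 3 cc * g1 = g1 * jK 3 cc := by decide +kernel

theorem double_ind (P : Equiv.Perm (Ix 3) → Prop) (lj : ∀ κ s, P s → P (jK 3 κ * s))
    (lt : ∀ τ s, P s → P (tS 3 τ * s)) (rj : ∀ κ s, P s → P (s * jK 3 κ))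
    (rt : ∀ τ s, P s → P (s * tS 3 τ)) (p1 : P 1) (px : P x3) (p2 : P g2) (s) : P s := by
  have pg : P g1 := by
    obtain ⟨τ, τ', h⟩ := W2
    rw [← h]; exact rt _ _ (lt _ _ px)
  have pgx : P (g1 * x3) := by
    obtain ⟨κ, τ, κ', h⟩ := W6h
    rw [h]; exact rj _ _ (lj _ _ (lt _ _ p2))
  have base : ∀ g : Equiv.Perm (Ix 3), P g → P (g * x3) → jK 3 cc * g = g * jK 3 cc →
      ∀ s : Equiv.Perm (Ix 3), s (0, 0) = (0, 0) → s (0, 1) = (0, 1) → s (1, 0) = (1, 0) →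
      P (g * s) := by
    intro g hg hgx hc s h0 h1 h2
    rcases D5 s h0 h1 h2 with rfl | rfl | rfl | rfl | rfl | rfl
    · rwa [mul_one]
    · exact rj _ _ hg
    · exact hgx
    · rw [← mul_assoc]; exact rj _ _ hgx
    · rw [← mul_assoc, ← hc, mul_assoc]; exact lj _ _ hgx
    · rw [← mul_assoc, ← mul_assoc, ← hc, mul_assoc _ g]; exact rj _ _ (lj _ _ hgx)
  have lcan : ∀ κ τ s, P (jK 3 κ * tS 3 τ * s) → P s := by
    intro κ τ s h
    have := lt τ⁻¹ _ (lj κ⁻¹ _ h)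
    rwa [mul_assoc, map_inv, map_inv, inv_mul_cancel_left, inv_mul_cancel_left] at this
  have rcan : ∀ κ τ s, P (s * (jK 3 κ * tS 3 τ)) → P s := by
    intro κ τ s h
    have := rj κ⁻¹ _ (rt τ⁻¹ _ h)
    rwa [← mul_assoc, map_inv, map_inv, mul_inv_cancel_right, mul_inv_cancel_right] at this
  have ne : ∀ (s : Equiv.Perm (Ix 3)) (p q r : Ix 3), s p = r → q ≠ p → s q ≠ r :=
    fun s p q r h hq h' => hq (s.injective (h'.trans h.symm))
  obtain ⟨κ, τ, h0⟩ := D1 (s (0, 0))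
  apply lcan κ τ
  generalize hs : jK 3 κ * tS 3 τ * s = s1
  replace h0 : s1 (0, 0) = (0, 0) := by rw [← hs]; exact h0
  clear hs
  obtain ⟨κ, τ, h0', h1⟩ := D2 (s1 (0, 1)) (ne _ _ _ _ h0 (by decide))
  apply lcan κ τ
  generalize hs : jK 3 κ * tS 3 τ * s1 = s2
  replace h0 : s2 (0, 0) = (0, 0) := by rw [← hs, Equiv.Perm.mul_apply, h0, h0']
  replace h1 : s2 (0, 1) = (0, 1) ∨ s2 (0, 1) = (1, 0) := by rw [← hs]; exact h1
  clear hs h0'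
  rcases h1 with h1 | h1
  · obtain ⟨κ, τ, h0', h1', h2⟩ := D3 (s2 (1, 0)) (ne _ _ _ _ h0 (by decide))
      (ne _ _ _ _ h1 (by decide))
    apply lcan κ τ
    rw [← one_mul (_ * _)]
    refine base 1 p1 (by rwa [one_mul]) (by simp) _ ?_ ?_ h2
    · rw [Equiv.Perm.mul_apply, h0, h0']
    · rw [Equiv.Perm.mul_apply, h1, h1']
  · have i0 : s2⁻¹ (0, 0) = (0, 0) := by rw [Equiv.Perm.inv_eq_iff_eq, h0]
    have i1 : s2⁻¹ (1, 0) = (0, 1) := by rw [Equiv.Perm.inv_eq_iff_eq, h1]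
    obtain ⟨κ, τ, h0', h1', h2⟩ := D3' (s2⁻¹ (0, 1)) (ne _ _ _ _ i0 (by decide))
      (ne _ _ _ _ i1 (by decide))
    apply rcan κ τ
    have : s2 * (jK 3 κ * tS 3 τ) = g1 * (g1⁻¹ * (s2 * (jK 3 κ * tS 3 τ))) := by
      rw [mul_inv_cancel_left]
    rw [this, g1_inv]
    refine base g1 pg pgx cg1 _ ?_ ?_ ?_
    · rw [Equiv.Perm.mul_apply, Equiv.Perm.mul_apply, h0', h0]; decide
    · rw [Equiv.Perm.mul_apply, Equiv.Perm.mul_apply, h1', h1]; decide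
    · rw [Equiv.Perm.mul_apply, Equiv.Perm.mul_apply, h2]
      rw [show s2 (s2⁻¹ (0, 1)) = (0, 1) from s2.apply_symm_apply _]; decide

end doublecoset


/-- Functions on pairs of words. -/
abbrev VV (m n : ℕ) := ((Ix 3 → Fin m) × (Ix 3 → Fin n)) → ℂ

noncomputable def opA (m n : ℕ) : Equiv.Perm (Ix 3) →* Module.End ℂ (VV m n) where
  toFun σ := LinearMap.funLeft ℂ ℂ fun p => (p.1 ∘ σ, p.2)
  map_one' := by ext; rfl
  map_mul' _ _ := by ext; rfl

noncomputable def opB (m n : ℕ) : Equiv.Perm (Ix 3) →* Module.End ℂ (VV m n) where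
  toFun σ := LinearMap.funLeft ℂ ℂ fun p => (p.1, p.2 ∘ σ)
  map_one' := by ext; rfl
  map_mul' _ _ := by ext; rfl

noncomputable def AA (m n : ℕ) : GA →ₐ[ℂ] Module.End ℂ (VV m n) := MonoidAlgebra.lift ℂ _ _ (opA m n)
noncomputable def BB (m n : ℕ) : GA →ₐ[ℂ] Module.End ℂ (VV m n) := MonoidAlgebra.lift ℂ _ _ (opB m n)

section ops
variable {m n : ℕ}

theorem AA_oo (σ) : AA m n (oo σ) = opA m n σ := by simp [AA, oo]
theorem BB_oo (σ) : BB m n (oo σ) = opB m n σ := by simp [BB, oo]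
theorem AA_apply (σ) (φ : VV m n) (a b) : AA m n (oo σ) φ (a, b) = φ (a ∘ σ, b) := by
  rw [AA_oo]; rfl
theorem BB_apply (σ) (φ : VV m n) (a b) : BB m n (oo σ) φ (a, b) = φ (a, b ∘ σ) := by
  rw [BB_oo]; rfl

theorem AB_commute (x y : GA) : AA m n x * BB m n y = BB m n y * AA m n x := by
  induction x using MonoidAlgebra.induction_on with
  | of σ =>
    induction y using MonoidAlgebra.induction_on with
    | of τ =>
      change AA m n (oo σ) * BB m n (oo τ) = BB m n (oo τ) * AA m n (oo σ)
      rw [AA_oo, BB_oo]; ext; rfl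
    | add x y hx hy => rw [map_add, mul_add, add_mul, hx, hy]
    | smul c x hx => rw [map_smul, mul_smul_comm, smul_mul_assoc, hx]
  | add x y hx hy => rw [map_add, mul_add, add_mul, hx, hy]
  | smul c x hx => rw [map_smul, mul_smul_comm, smul_mul_assoc, hx]

theorem AB_comm (x y : GA) (φ : VV m n) : AA m n x (BB m n y φ) = BB m n y (AA m n x φ) :=
  LinearMap.congr_fun (AB_commute x y) φ

theorem A_mul (x y : GA) (φ : VV m n) : AA m n (x * y) φ = AA m n x (AA m n y φ) := by
  rw [map_mul]; rfl
theorem B_mul (x y : GA) (φ : VV m n) : BB m n (x * y) φ = BB m n x (BB m n y φ) := by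
  rw [map_mul]; rfl

theorem bal_iff (φ : VV m n) (s) : Bal 3 φ s ↔ AA m n (eK * oo s) φ = BB m n (eK * oo s⁻¹) φ := by
  have h1 : ∀ a b, AA m n (eK * oo s) φ (a, b) =
      (1 / 8 : ℂ) * ∑ k, φ (a ∘ (jK 3 k * s : Equiv.Perm (Ix 3)), b) := by
    intro a b
    simp only [eK, smul_mul_assoc, Finset.sum_mul, ← oo_mul, map_smul, map_sum]
    simp [AA_apply]
  have h2 : ∀ a b, BB m n (eK * oo s⁻¹) φ (a, b) =
      (1 / 8 : ℂ) * ∑ k, φ (a, b ∘ (jK 3 k * s⁻¹ : Equiv.Perm (Ix 3))) := by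
    intro a b
    simp only [eK, smul_mul_assoc, Finset.sum_mul, ← oo_mul, map_smul, map_sum]
    simp [BB_apply]
  constructor
  · intro h
    funext ⟨a, b⟩
    rw [h1, h2, h a b]
  · intro h a b
    have := congrFun h (a, b)
    rw [h1, h2] at this
    exact mul_left_cancel₀ (by norm_num) this

theorem winv_iff (φ : VV m n) : WInv 3 φ ↔ (∀ κ, AA m n (oo (jK 3 κ)) φ = φ) ∧
    (∀ κ, BB m n (oo (jK 3 κ)) φ = φ) ∧
    (∀ τ, AA m n (oo (tS 3 τ)) (BB m n (oo (tS 3 τ)) φ) = φ) := by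
  constructor
  · intro h
    refine ⟨fun κ => ?_, fun κ => ?_, fun κ => ?_⟩ <;> funext ⟨a, b⟩
    · rw [AA_apply]; exact h.ka κ a b
    · rw [BB_apply]; exact h.kb κ a b
    · rw [AA_apply, BB_apply]; exact h.t κ a b
  · rintro ⟨h1, h2, h3⟩
    refine ⟨fun κ a b => ?_, fun κ a b => ?_, fun κ a b => ?_⟩
    · have := congrFun (h1 κ) (a, b)
      rwa [AA_apply] at this
    · have := congrFun (h2 κ) (a, b)
      rwa [BB_apply] at this
    · have := congrFun (h3 κ) (a, b)
      rwa [AA_apply, BB_apply] at this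

/-- The projector onto the minimal cubic relations. -/
noncomputable def EE (m n : ℕ) : Module.End ℂ (VV m n) :=
  AA m n e1 * BB m n e2 + AA m n e2 * BB m n e1

theorem EE_apply (φ : VV m n) : EE m n φ = AA m n e1 (BB m n e2 φ) + AA m n e2 (BB m n e1 φ) := rfl

theorem EE_idem : EE m n * EE m n = EE m n := by
  have h : ∀ a b c d : GA, (AA m n a * BB m n b) * (AA m n c * BB m n d) =
      AA m n (a * c) * BB m n (b * d) := by
    intro a b c d
    rw [map_mul, map_mul, mul_assoc, ← mul_assoc (BB m n b), ← AB_commute]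
    simp only [mul_assoc]
  rw [EE]
  simp only [mul_add, add_mul, h, e1_e1, e1_e2, e2_e1, e2_e2, map_zero, mul_zero,
    add_zero, zero_add]

theorem term_facts (x y : GA) (hx : ee * x = x) (hy : ee * y = y) (ψ : VV m n) :
    WInv 3 (AA m n x (BB m n y ψ)) ∧ AA m n (eK * oo x3) (AA m n x (BB m n y ψ)) = 0 ∧
    BB m n (eK * oo x3⁻¹) (AA m n x (BB m n y ψ)) = 0 := by
  refine ⟨(winv_iff _).2 ⟨fun κ => ?_, fun κ => ?_, fun τ => ?_⟩, ?_, ?_⟩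
  · rw [← A_mul, ← hx, ← mul_assoc, j_ee]
  · rw [AB_comm, ← B_mul, ← hy, ← mul_assoc, j_ee]
  · rw [← AB_comm x, ← B_mul, ← A_mul, ← hx, ← hy, ← mul_assoc, ← mul_assoc, t_ee, smul_mul_assoc,
      smul_mul_assoc, hx, hy, map_smul, map_smul, LinearMap.smul_apply, LinearMap.smul_apply,
      map_smul, smul_smul, sg_sq, one_smul]
  · rw [← A_mul, ← hx, ← mul_assoc, eK_x3_ee, zero_mul, map_zero]; rfl
  · rw [AB_comm, ← B_mul, ← hy, x3_inv, ← mul_assoc, eK_x3_ee, zero_mul, map_zero]; rfl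

/-- (α) -/
theorem range_E (ψ : VV m n) : WInv 3 (EE m n ψ) ∧ Bal 3 (EE m n ψ) x3 := by
  obtain ⟨h1, h2, h3⟩ := term_facts e1 e2 ee_e1 ee_e2 ψ
  obtain ⟨k1, k2, k3⟩ := term_facts e2 e1 ee_e2 ee_e1 ψ
  rw [winv_iff] at h1 k1
  constructor
  · rw [winv_iff, EE_apply]
    refine ⟨fun κ => ?_, fun κ => ?_, fun τ => ?_⟩
    · rw [map_add, h1.1, k1.1]
    · rw [map_add, h1.2.1, k1.2.1]
    · rw [map_add, map_add, h1.2.2, k1.2.2]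
  · rw [bal_iff, EE_apply, map_add, map_add, h2, h3, k2, k3]

section winv
variable {φ : VV m n}

theorem A_eK (h : WInv 3 φ) : AA m n eK φ = φ := by
  have := ((winv_iff φ).1 h).1
  simp only [eK, map_smul, map_sum, LinearMap.smul_apply, LinearMap.sum_apply, this]
  rw [Finset.sum_const, Finset.card_univ, card8, ← Nat.cast_smul_eq_nsmul ℂ, smul_smul]
  norm_num
theorem B_eK (h : WInv 3 φ) : BB m n eK φ = φ := by
  have := ((winv_iff φ).1 h).2.1
  simp only [eK, map_smul, map_sum, LinearMap.smul_apply, LinearMap.sum_apply, this]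
  rw [Finset.sum_const, Finset.card_univ, card8, ← Nat.cast_smul_eq_nsmul ℂ, smul_smul]
  norm_num

theorem A_t_B (h : WInv 3 φ) (τ) : AA m n (oo (tS 3 τ)) φ = BB m n (oo (tS 3 τ⁻¹)) φ := by
  have h3 := ((winv_iff φ).1 h).2.2 τ
  conv_rhs => rw [← h3]
  rw [AB_comm, ← B_mul, ← oo_mul, ← map_mul, inv_mul_cancel, map_one, oo_one, map_one]
  rfl

theorem A_eS_B (h : WInv 3 φ) : AA m n eS φ = BB m n eS φ := by
  simp only [eS, map_smul, map_sum, LinearMap.smul_apply, LinearMap.sum_apply, A_t_B h]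
  congr 1
  conv_rhs => rw [← Equiv.sum_comp (Equiv.inv _)]
  simp [sg_inv]

theorem A_ee_B (h : WInv 3 φ) : AA m n ee φ = BB m n ee φ := by
  rw [ee, ← eS_eK, A_mul, B_mul, A_eK h, B_eK h, A_eS_B h]

theorem A_T (h : WInv 3 φ) : AA m n TT φ = AA m n (eK * oo g2) (AA m n eS φ) := by
  rw [T_left, ee, ← eS_eK, ← mul_assoc, A_mul, A_eK h, A_mul]
theorem B_T (h : WInv 3 φ) : BB m n TT φ = BB m n (eK * oo g2) (BB m n eS φ) := by
  rw [T_left, ee, ← eS_eK, ← mul_assoc, B_mul, B_eK h, B_mul]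
theorem A_T' (h : WInv 3 φ) : AA m n TT φ = AA m n eS (AA m n (eK * oo g2) φ) := by
  rw [T_right, ee, ← eS_eK, A_mul, A_eK h, mul_assoc, A_mul]
theorem B_T' (h : WInv 3 φ) : BB m n TT φ = BB m n eS (BB m n (eK * oo g2) φ) := by
  rw [T_right, ee, ← eS_eK, B_mul, B_eK h, mul_assoc, B_mul]

/-- (β) -/
theorem E_zero (h : WInv 3 φ) (hb : Bal 3 φ g2) : EE m n φ = 0 := by
  have hT : AA m n TT φ = BB m n TT φ := by
    rw [bal_iff, g2_inv] at hb
    rw [A_T' h, hb, AB_comm, A_eS_B h, B_T h]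
  have he := A_ee_B h
  have h1 : AA m n e1 φ = BB m n e1 φ := by
    simp only [e1, map_smul, map_add, LinearMap.smul_apply, LinearMap.add_apply, hT, he]
  have h2 : AA m n e2 φ = BB m n e2 φ := by
    simp only [e2, map_smul, map_sub, LinearMap.smul_apply, LinearMap.sub_apply, hT, he]
  rw [EE_apply, ← h1, ← h2, ← A_mul, ← A_mul, e1_e2, e2_e1, map_zero]
  simp

/-- (γ), algebraic part -/
theorem T_of_E (h : WInv 3 φ) (hE : EE m n φ = 0) : AA m n TT φ = BB m n TT φ := by
  have he := A_ee_B h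
  have p1 : AA m n e1 (BB m n e2 φ) = 0 := by
    have := congrArg (AA m n e1) hE
    rwa [EE_apply, map_add, ← A_mul, ← A_mul, e1_e1, e1_e2, map_zero, LinearMap.zero_apply,
      add_zero, map_zero] at this
  have p2 : AA m n e2 (BB m n e1 φ) = 0 := by
    have := congrArg (AA m n e2) hE
    rwa [EE_apply, map_add, ← A_mul, ← A_mul, e2_e2, e2_e1, map_zero, LinearMap.zero_apply,
      zero_add, map_zero] at this
  have q : ∀ x, x * ee = x → AA m n x φ = AA m n x (BB m n e1 φ) + AA m n x (BB m n e2 φ) := by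
    intro x hx
    conv_lhs => rw [← hx, A_mul, he, ← e1_add_e2]
    rw [map_add, LinearMap.add_apply, map_add]
  have q' : ∀ x, x * ee = x → BB m n x φ = AA m n e1 (BB m n x φ) + AA m n e2 (BB m n x φ) := by
    intro x hx
    conv_lhs => rw [← hx, B_mul, ← he, ← e1_add_e2]
    rw [map_add, LinearMap.add_apply, map_add, AB_comm, AB_comm]
  have h1 : AA m n e1 φ = BB m n e1 φ := by
    have k := q e1 e1_ee
    have k' := q' e1 e1_ee
    rw [p1, add_zero] at k
    rw [p2, add_zero] at k'
    exact k.trans k'.symm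
  have h2 : AA m n e2 φ = BB m n e2 φ := by
    have k := q e2 e2_ee
    have k' := q' e2 e2_ee
    rw [p2, zero_add] at k
    rw [p1, zero_add] at k'
    exact k.trans k'.symm
  rw [T_eq]
  simp only [map_sub, map_smul, LinearMap.sub_apply, LinearMap.smul_apply, h1, h2]

end winv
end ops


theorem swap_conj : ∀ i j : Fin 3, i ≠ j →
    ∃ ρ : Equiv.Perm (Fin 3), Equiv.swap i j = ρ * Equiv.swap 0 1 * ρ⁻¹ := by decide +kernel

theorem B_one {m n : ℕ} (D : VV m n) : BB m n (oo (tS 3 1)) D = D := by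
  rw [map_one, oo_one, map_one]; rfl

theorem sign_of_swap {m n : ℕ} (D : VV m n) (h0 : BB m n (oo (tS 3 (Equiv.swap 0 1))) D = -D)
    (hc : ∀ τ, AA m n (oo (tS 3 τ)) (BB m n (oo (tS 3 τ)) D) = D) (τ) :
    BB m n (oo (tS 3 τ)) D = sg τ • D := by
  induction τ using Equiv.Perm.swap_induction_on with
  | one => rw [B_one, sg_one, one_smul]
  | swap_mul f i j hij hf =>
    obtain ⟨ρ, hρ⟩ := swap_conj i j hij
    rw [sg_mul, sg_swap hij, map_mul, oo_mul, B_mul, hf, map_smul, neg_one_mul, neg_smul,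
      ← smul_neg]
    congr 1
    rw [hρ, map_mul, map_mul, oo_mul, oo_mul, B_mul, B_mul]
    have h1 : BB m n (oo (tS 3 ρ⁻¹)) D = AA m n (oo (tS 3 ρ)) D := by
      conv_lhs => rw [← hc ρ]
      rw [← AB_comm, ← B_mul, ← oo_mul, ← map_mul, inv_mul_cancel, B_one]
    rw [h1, ← AB_comm, h0, map_neg, map_neg, ← AB_comm, hc]

theorem B_eS_of {m n : ℕ} (D : VV m n) (h : ∀ τ, BB m n (oo (tS 3 τ)) D = sg τ • D) :
    BB m n eS D = D := by
  simp only [eS, map_smul, map_sum, LinearMap.smul_apply, LinearMap.sum_apply, h, smul_smul, sg_sq]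
  simp only [one_smul, Finset.sum_const, Finset.card_univ, card6]
  rw [← Nat.cast_smul_eq_nsmul ℂ, smul_smul]
  norm_num

theorem bal_g2 {m n : ℕ} {φ : VV m n} (h : WInv 3 φ) (hx : Bal 3 φ x3) (hE : EE m n φ = 0) :
    Bal 3 φ g2 := by
  have bg : AA m n (eK * oo g1) φ = BB m n (eK * oo g1) φ := by
    obtain ⟨τ, τ', hg⟩ := W2
    have : Bal 3 φ g1 := by
      rw [← hg]; exact bal_right_t h _ (bal_left_t h _ hx)
    rwa [bal_iff, g1_inv] at this
  have byy : AA m n (eK * oo y3) φ = BB m n (eK * oo y3⁻¹) φ :=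
    (bal_iff φ y3).1 (bal_right_t h _ hx)
  have hl : AA m n (eK * oo g1 * eK * oo y3 * eK) φ = BB m n (eK * oo y3⁻¹ * eK * oo g1 * eK) φ := by
    rw [A_mul, A_eK h, B_mul, B_eK h, mul_assoc _ eK, A_mul, mul_assoc _ eK, B_mul, ← bg, ← AB_comm,
      byy]
  rw [W3_alg, W3i_alg] at hl
  have t0 : (Equiv.swap 0 1 : Equiv.Perm (Fin 3))⁻¹ = Equiv.swap 0 1 := by simp
  have c1 : AA m n (eK * oo (g2 * tS 3 (Equiv.swap 0 1)) * eK) φ =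
      BB m n (oo (tS 3 (Equiv.swap 0 1))) (AA m n (eK * oo g2) φ) := by
    rw [A_mul, A_eK h, oo_mul, ← mul_assoc, A_mul, A_t_B h, AB_comm, t0]
  have c2 : BB m n (eK * oo (tS 3 (Equiv.swap 0 1) * g2) * eK) φ =
      BB m n (oo (tS 3 (Equiv.swap 0 1))) (BB m n (eK * oo g2) φ) := by
    rw [B_mul, B_eK h, oo_mul, ← mul_assoc, ← t_eK, mul_assoc, B_mul]
  have c3 : AA m n (eK * oo g2 * eK) φ = AA m n (eK * oo g2) φ := by rw [A_mul, A_eK h]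
  have c4 : BB m n (eK * oo g2 * eK) φ = BB m n (eK * oo g2) φ := by rw [B_mul, B_eK h]
  set D := AA m n (eK * oo g2) φ - BB m n (eK * oo g2) φ with hD
  have hD0 : BB m n (oo (tS 3 (Equiv.swap 0 1))) D = -D := by
    simp only [map_smul, map_add, LinearMap.smul_apply, LinearMap.add_apply, c1, c2, c3, c4] at hl
    have hl2 := smul_right_injective _ (by norm_num : (1 / 2 : ℂ) ≠ 0) hl
    rw [hD, map_sub, neg_sub, sub_eq_sub_iff_add_eq_add, add_comm, hl2, add_comm]
  have hc : ∀ τ, AA m n (oo (tS 3 τ)) (BB m n (oo (tS 3 τ)) D) = D := by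
    intro τ
    have h3 := ((winv_iff φ).1 h).2.2 τ
    rw [hD, ← c3, ← c4, map_sub, map_sub]
    congr 1
    · rw [← AB_comm, ← A_mul, t_g2, A_mul, h3]
    · rw [← B_mul, t_g2, B_mul, AB_comm, h3]
  have hS := B_eS_of D (sign_of_swap D hD0 hc)
  have hz : D = 0 := by
    rw [← hS, hD, map_sub, ← AB_comm, ← A_eS_B h, ← A_T h, ← B_T' h, T_of_E h hE, sub_self]
  rw [bal_iff, g2_inv]
  exact sub_eq_zero.1 hz

/-- (γ) -/
theorem bal_all {m n : ℕ} {φ : VV m n} (h : WInv 3 φ) (hx : Bal 3 φ x3) (hE : EE m n φ = 0) (s) :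
    Bal 3 φ s :=
  double_ind (Bal 3 φ) (fun κ _ hs => bal_left_j h κ hs) (fun τ _ hs => bal_left_t h τ hs)
    (fun κ _ hs => bal_right_j h κ hs) (fun τ _ hs => bal_right_t h τ hs) (bal_one h) hx
    (bal_g2 h hx hE) s


theorem Q_le_K (m n : ℕ) : R1kerPsiBar2 m n ≤ kerPsiBarDeg m n 3 := by
  refine Submodule.span_le.2 ?_
  rintro _ ⟨w, q, hq, rfl⟩
  refine ⟨?_, ?_⟩
  · have : q ∈ RingHom.ker (PsiBar m n) := hq.1
    exact Ideal.mul_mem_left _ _ this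
  · have h1 : q.IsHomogeneous 2 := hq.2
    have : (X w * q).IsHomogeneous (1 + 2) := (isHomogeneous_X ℂ w).mul h1
    exact this

/-- The word function of a functional. -/
noncomputable def PF (m n : ℕ) : Module.Dual ℂ (MvPolynomial (PermIdx m n) ℂ) →ₗ[ℂ] VV m n where
  toFun F := fun p => F (mon 3 p.1 p.2)
  map_add' _ _ := rfl
  map_smul' _ _ := rfl

theorem PF_iff {m n : ℕ} (F : Module.Dual ℂ (MvPolynomial (PermIdx m n) ℂ))
    (hF : ∀ f ∈ R1kerPsiBar2 m n, F f = 0) :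
    (∀ f ∈ kerPsiBarDeg m n 3, F f = 0) ↔ EE m n (PF m n F) = 0 := by
  have hw : WInv 3 (PF m n F) := inv_of_F F
  constructor
  · intro h
    exact E_zero hw (bal_of_kills F h g2)
  · intro h
    exact kills_of_bal hw (bal_all hw ((kills_Q_iff F).1 hF) h) F (fun _ _ => rfl)

theorem finrank_eq_range (m n : ℕ) : Module.finrank ℂ
      (↥(kerPsiBarDeg m n 3) ⧸
        Submodule.comap (kerPsiBarDeg m n 3).subtype (R1kerPsiBar2 m n)) =
    Module.finrank ℂ (LinearMap.range (EE m n)) := by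
  rw [← Subspace.dual_finrank_eq]
  set K := kerPsiBarDeg m n 3
  set Q := R1kerPsiBar2 m n
  let f : Q.dualAnnihilator →ₗ[ℂ] Module.Dual ℂ (K ⧸ Submodule.comap K.subtype Q) :=
    { toFun := fun F => (Submodule.comap K.subtype Q).liftQ (F.1 ∘ₗ K.subtype) (by
        intro x hx
        exact (Submodule.mem_dualAnnihilator _).1 F.2 _ hx)
      map_add' := by intro x y; ext; rfl
      map_smul' := by intro x y; ext; rfl }
  have hf : ∀ F x, f F (Submodule.Quotient.mk x) = F.1 x.1 := fun F x => rfl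
  let g : Q.dualAnnihilator →ₗ[ℂ] LinearMap.range (EE m n) :=
    (EE m n).rangeRestrict ∘ₗ PF m n ∘ₗ Q.dualAnnihilator.subtype
  have hg : ∀ F, (g F).1 = EE m n (PF m n F.1) := fun F => rfl
  have f_surj : Function.Surjective f := by
    intro G
    obtain ⟨F, hF⟩ := LinearMap.exists_extend (G ∘ₗ (Submodule.comap K.subtype Q).mkQ)
    have hF' : ∀ x : K, F x.1 = G (Submodule.Quotient.mk x) := fun x => LinearMap.congr_fun hF x
    refine ⟨⟨F, ?_⟩, ?_⟩
    · rw [Submodule.mem_dualAnnihilator]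
      intro w hw
      have := hF' ⟨w, Q_le_K m n hw⟩
      rw [this, (Submodule.Quotient.mk_eq_zero _).2, map_zero]
      exact hw
    · apply LinearMap.ext
      intro x
      obtain ⟨x, rfl⟩ := Submodule.Quotient.mk_surjective _ x
      rw [hf, hF']
  have g_surj : Function.Surjective g := by
    rintro ⟨φ, ψ, rfl⟩
    obtain ⟨h1, h2⟩ := range_E ψ
    obtain ⟨F, hF⟩ := exists_F h1
    have hPF : PF m n F = EE m n ψ := funext fun p => hF p.1 p.2
    refine ⟨⟨F, ?_⟩, ?_⟩
    · rw [Submodule.mem_dualAnnihilator]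
      apply (kills_Q_iff F).2
      have : (fun p : (Ix 3 → Fin m) × (Ix 3 → Fin n) => F (mon 3 p.1 p.2)) = EE m n ψ := hPF
      rw [this]
      exact h2
    · apply Subtype.ext
      rw [hg, hPF]
      exact LinearMap.congr_fun EE_idem ψ
  have hker : LinearMap.ker f = LinearMap.ker g := by
    ext F
    rw [LinearMap.mem_ker, LinearMap.mem_ker]
    have e1 : f F = 0 ↔ ∀ x ∈ K, F.1 x = 0 := by
      constructor
      · intro h x hx
        rw [← hf F ⟨x, hx⟩, h]; rfl
      · intro h
        apply LinearMap.ext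
        intro x
        obtain ⟨x, rfl⟩ := Submodule.Quotient.mk_surjective _ x
        rw [hf, h x.1 x.2]; rfl
    have e2 : g F = 0 ↔ EE m n (PF m n F.1) = 0 := by
      rw [← hg]; exact (Submodule.coe_eq_zero).symm
    rw [e1, e2]
    exact PF_iff F.1 ((Submodule.mem_dualAnnihilator _).1 F.2)
  rw [← (f.quotKerEquivOfSurjective f_surj).finrank_eq,
    ← (g.quotKerEquivOfSurjective g_surj).finrank_eq]
  exact (Submodule.quotEquivOfEq _ _ hker).finrank_eq

theorem finrank_range_trace (m n : ℕ) :
    (Module.finrank ℂ (LinearMap.range (EE m n)) : ℂ) = LinearMap.trace ℂ _ (EE m n) := by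
  symm
  apply LinearMap.IsProj.trace
  refine ⟨fun x => ⟨x, rfl⟩, ?_⟩
  rintro _ ⟨x, rfl⟩
  exact LinearMap.congr_fun EE_idem x


theorem trace_funLeft {Z : Type*} [Fintype Z] [DecidableEq Z] (h : Z → Z) :
    LinearMap.trace ℂ (Z → ℂ) (LinearMap.funLeft ℂ ℂ h) = Fintype.card {z // h z = z} := by
  rw [LinearMap.trace_eq_matrix_trace ℂ (Pi.basisFun ℂ Z), Matrix.trace]
  simp only [Matrix.diag_apply, LinearMap.toMatrix_apply, Pi.basisFun_apply, Pi.basisFun_repr,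
    LinearMap.funLeft_apply, Pi.single_apply]
  rw [Fintype.card_subtype, Finset.sum_boole]

noncomputable def opC (m : ℕ) : Equiv.Perm (Ix 3) →* Module.End ℂ ((Ix 3 → Fin m) → ℂ) where
  toFun σ := LinearMap.funLeft ℂ ℂ fun p => p ∘ σ
  map_one' := by ext; rfl
  map_mul' _ _ := by ext; rfl

noncomputable def CC (m : ℕ) : GA →ₐ[ℂ] Module.End ℂ ((Ix 3 → Fin m) → ℂ) :=
  MonoidAlgebra.lift ℂ _ _ (opC m)

/-- Character of the group algebra on words. -/
noncomputable def chi (m : ℕ) : GA →ₗ[ℂ] ℂ := LinearMap.trace ℂ _ ∘ₗ (CC m).toLinearMap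

theorem chi_mul_comm (m : ℕ) (x y : GA) : chi m (x * y) = chi m (y * x) := by
  simp only [chi, LinearMap.comp_apply, AlgHom.toLinearMap_apply, map_mul]
  exact LinearMap.trace_mul_comm ℂ _ _

theorem chi_oo (m : ℕ) (σ) :
    chi m (oo σ) = (Fintype.card {a : Ix 3 → Fin m // a ∘ σ = a} : ℂ) := by
  have : CC m (oo σ) = LinearMap.funLeft ℂ ℂ fun p => p ∘ σ := by simp [CC, oo]; rfl
  simp only [chi, LinearMap.comp_apply, AlgHom.toLinearMap_apply, this]
  rw [trace_funLeft]

theorem trace_AB (m n : ℕ) (x y : GA) :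
    LinearMap.trace ℂ _ (AA m n x * BB m n y) = chi m x * chi n y := by
  induction x using MonoidAlgebra.induction_on with
  | of σ =>
    induction y using MonoidAlgebra.induction_on with
    | of τ =>
      change LinearMap.trace ℂ _ (AA m n (oo σ) * BB m n (oo τ)) = chi m (oo σ) * chi n (oo τ)
      have : opA m n σ * opB m n τ = LinearMap.funLeft ℂ ℂ fun p => (p.1 ∘ σ, p.2 ∘ τ) := by
        ext; rfl
      rw [AA_oo, BB_oo, chi_oo, chi_oo, this, trace_funLeft, ← Nat.cast_mul, ← Fintype.card_prod]
      congr 1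
      refine Fintype.card_congr ?_
      refine (Equiv.subtypeEquivRight ?_).trans
        (Equiv.subtypeProdEquivProd (p := fun a : Ix 3 → Fin m => a ∘ σ = a)
          (q := fun b : Ix 3 → Fin n => b ∘ τ = b))
      rintro ⟨a, b⟩
      simp [Prod.ext_iff]
    | add x y hx hy => rw [map_add, mul_add, map_add, map_add, hx, hy, mul_add]
    | smul c x hx => rw [map_smul, mul_smul_comm, map_smul, map_smul, hx, mul_smul_comm]
  | add x y hx hy => rw [map_add, add_mul, map_add, map_add, hx, hy, add_mul]
  | smul c x hx => rw [map_smul, smul_mul_assoc, map_smul, map_smul, hx, smul_mul_assoc]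

instance sameCycleDec (σ : Equiv.Perm (Ix 3)) :
    DecidableRel (α := Ix 3) (β := Ix 3) (Equiv.Perm.SameCycle.setoid σ).r := fun x y =>
  inferInstanceAs (Decidable (σ.SameCycle x y))

/-- Number of cycles, counted as orbits. -/
def cyc (σ : Equiv.Perm (Ix 3)) : ℕ := Fintype.card (Quotient (Equiv.Perm.SameCycle.setoid σ))

theorem card_fix (m : ℕ) (σ : Equiv.Perm (Ix 3)) :
    Fintype.card {a : Ix 3 → Fin m // a ∘ σ = a} = m ^ cyc σ := by
  have e : {a : Ix 3 → Fin m // a ∘ σ = a} ≃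
      (Quotient (Equiv.Perm.SameCycle.setoid σ) → Fin m) :=
    { toFun := fun a => Quotient.lift a.1 (by
        rintro p q ⟨k, rfl⟩
        have hs : ∀ p, a.1 (σ p) = a.1 p := fun p => congrFun a.2 p
        have hk : ∀ (k : ℕ) p, a.1 ((σ ^ k) p) = a.1 p := by
          intro k
          induction k with
          | zero => intro p; rfl
          | succ k ih => intro p; rw [pow_succ, Equiv.Perm.mul_apply, ih, hs]
        cases k with
        | ofNat k => exact (hk k p).symm
        | negSucc k =>
          rw [zpow_negSucc]
          have := hk (k + 1) ((σ ^ (k + 1))⁻¹ p)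
          rw [show (σ ^ (k + 1)) ((σ ^ (k + 1))⁻¹ p) = p from
            (σ ^ (k + 1)).apply_symm_apply p] at this
          exact this)
      invFun := fun f => ⟨fun p => f (Quotient.mk _ p), by
        funext p
        exact congrArg f (Quotient.sound ⟨-1, by simp⟩)⟩
      left_inv := fun a => rfl
      right_inv := fun f => by
        funext q
        induction q using Quotient.inductionOn with
        | h p => rfl }
  rw [Fintype.card_congr e, Fintype.card_fun, Fintype.card_fin, cyc]

theorem hist1 : ∀ j ∈ Finset.range 7,
    ∑ x : (Fin 3 → Equiv.Perm (Fin 2)) × Equiv.Perm (Fin 3),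
      (if cyc (jK 3 x.1 * tS 3 x.2) = j then (Equiv.Perm.sign x.2 : ℤ) else 0) =
    [0, 8, 2, -11, -3, 3, 1].getD j 0 := by
  decide +kernel

theorem hist2 : ∀ j ∈ Finset.range 7,
    ∑ x : (Fin 3 → Equiv.Perm (Fin 2)) × Equiv.Perm (Fin 3),
      (if cyc (jK 3 x.1 * tS 3 x.2 * g2) = j then (Equiv.Perm.sign x.2 : ℤ) else 0) =
    [0, 2, 1, -2, -1, 0, 0].getD j 0 := by
  decide +kernel


theorem ee_sum (g : Equiv.Perm (Ix 3)) : ee * oo g =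
    (1 / 48 : ℂ) • ∑ x : (Fin 3 → Equiv.Perm (Fin 2)) × Equiv.Perm (Fin 3),
      sg x.2 • oo (jK 3 x.1 * tS 3 x.2 * g) := by
  rw [ee, eK, eS, Fintype.sum_prod_type]
  simp only [smul_mul_assoc, mul_smul_comm, Finset.sum_mul, Finset.mul_sum, oo_mul, smul_smul]
  simp only [Finset.smul_sum, smul_smul]
  try rw [Finset.sum_comm]
  refine Finset.sum_congr rfl fun τ _ => Finset.sum_congr rfl fun κ _ => ?_
  congr 1
  norm_num
  try ring

theorem cyc_lt (σ : Equiv.Perm (Ix 3)) : cyc σ < 7 := by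
  have : cyc σ ≤ Fintype.card (Ix 3) := Fintype.card_quotient_le _
  have h6 : Fintype.card (Ix 3) = 6 := by simp
  omega

theorem chi_hist (m : ℕ) (g : Equiv.Perm (Ix 3)) (h : ℕ → ℤ)
    (hh : ∀ j ∈ Finset.range 7,
      ∑ x : (Fin 3 → Equiv.Perm (Fin 2)) × Equiv.Perm (Fin 3),
        (if cyc (jK 3 x.1 * tS 3 x.2 * g) = j then (Equiv.Perm.sign x.2 : ℤ) else 0) = h j) :
    chi m (ee * oo g) = (1 / 48 : ℂ) * ∑ j ∈ Finset.range 7, (h j : ℂ) * (m : ℂ) ^ j := by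
  rw [ee_sum, map_smul, map_sum, smul_eq_mul]
  congr 1
  have h1 : ∀ j ∈ Finset.range 7, (h j : ℂ) * (m : ℂ) ^ j =
      ∑ x : (Fin 3 → Equiv.Perm (Fin 2)) × Equiv.Perm (Fin 3),
        (if cyc (jK 3 x.1 * tS 3 x.2 * g) = j then sg x.2 * (m : ℂ) ^ j else 0) := by
    intro j hj
    rw [← hh j hj, Int.cast_sum, Finset.sum_mul]
    refine Finset.sum_congr rfl fun x _ => ?_
    split_ifs <;> simp [sg]
  rw [Finset.sum_congr rfl h1, Finset.sum_comm]
  refine Finset.sum_congr rfl fun x _ => ?_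
  rw [map_smul, chi_oo, card_fix, Finset.sum_ite_eq, if_pos (Finset.mem_range.2 (cyc_lt _)),
    smul_eq_mul, Nat.cast_pow]

theorem chi_ee (m : ℕ) : chi m ee = (1 / 48 : ℂ) *
    (8 * m + 2 * m ^ 2 - 11 * m ^ 3 - 3 * m ^ 4 + 3 * m ^ 5 + m ^ 6) := by
  have := chi_hist m 1 (fun j => [0, 8, 2, -11, -3, 3, 1].getD j 0) (by
    simpa only [mul_one] using hist1)
  rw [oo_one, mul_one] at this
  rw [this]
  simp [Finset.sum_range_succ]
  ring

theorem chi_T (m : ℕ) : chi m TT = (1 / 48 : ℂ) * (2 * m + m ^ 2 - 2 * m ^ 3 - m ^ 4) := by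
  have := chi_hist m g2 (fun j => [0, 2, 1, -2, -1, 0, 0].getD j 0) hist2
  rw [T_right, chi_mul_comm, ← mul_assoc, eK_ee, this]
  simp [Finset.sum_range_succ]
  ring

theorem chi_e1 (m : ℕ) : chi m e1 =
    (m * (m + 1) * (m + 2) * (m + 3) * (m - 1) * (m - 2) : ℂ) / 72 := by
  rw [e1, map_smul, map_add, map_smul, map_smul, chi_ee, chi_T]
  simp only [smul_eq_mul]
  ring

theorem chi_e2 (m : ℕ) : chi m e2 = (m ^ 2 * (m + 1) ^ 2 * (m + 2) * (m - 1) : ℂ) / 144 := by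
  rw [e2, map_smul, map_sub, map_smul, chi_ee, chi_T]
  simp only [smul_eq_mul]
  ring

theorem trace_EE (m n : ℕ) : LinearMap.trace ℂ _ (EE m n) =
    chi m e1 * chi n e2 + chi m e2 * chi n e1 := by
  rw [EE, map_add, trace_AB, trace_AB]

theorem dvd72 (m : ℕ) : 72 ∣ m * (m + 1) * (m + 2) * (m + 3) * (m - 1) * (m - 2) := by
  rcases m with _ | _ | k
  · simp
  · simp
  · have h : ∀ x : ZMod 72, (x + 2) * (x + 3) * (x + 4) * (x + 5) * (x + 1) * x = 0 := by
      decide +kernel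
    have h2 := h (k : ZMod 72)
    rw [← ZMod.natCast_eq_zero_iff]
    simp only [Nat.add_sub_cancel, show k + 1 + 1 - 1 = k + 1 from rfl,
      show k + 1 + 1 - 2 = k from rfl]
    push_cast
    rw [← h2]; ring

theorem dvd144 (m : ℕ) : 144 ∣ m ^ 2 * (m + 1) ^ 2 * (m + 2) * (m - 1) := by
  rcases m with _ | k
  · simp
  · have h : ∀ x : ZMod 144, (x + 1) ^ 2 * (x + 2) ^ 2 * (x + 3) * x = 0 := by
      decide +kernel
    have h2 := h (k : ZMod 144)
    rw [← ZMod.natCast_eq_zero_iff, Nat.add_sub_cancel]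
    push_cast
    rw [← h2]; ring

theorem cast_e1 (m : ℕ) (hm : 1 ≤ m) :
    ((m * (m + 1) * (m + 2) * (m + 3) * (m - 1) * (m - 2) / 72 : ℕ) : ℂ) = chi m e1 := by
  rw [Nat.cast_div (dvd72 m) (by norm_num), chi_e1]
  rcases m with _ | _ | k
  · simp
  · simp
  · simp only [show k + 1 + 1 - 1 = k + 1 from rfl, show k + 1 + 1 - 2 = k from rfl]
    push_cast
    ring

theorem cast_e2 (m : ℕ) (hm : 1 ≤ m) :
    ((m ^ 2 * (m + 1) ^ 2 * (m + 2) * (m - 1) / 144 : ℕ) : ℂ) = chi m e2 := by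
  rw [Nat.cast_div (dvd144 m) (by norm_num), chi_e2]
  push_cast [hm]
  ring

/-- The space of minimal cubic relations among the generalized 2×2 permanents,
`(ker Ψ̄)₃ / (R̄₁·(ker Ψ̄)₂)`, has the stated dimension. -/
theorem dim_minimal_cubic_relations_permanents (m n : ℕ) (hm : 1 ≤ m) (hn : 1 ≤ n) :
    Module.finrank ℂ
      (↥(kerPsiBarDeg m n 3) ⧸
        Submodule.comap (kerPsiBarDeg m n 3).subtype (R1kerPsiBar2 m n)) =
      m * (m + 1) * (m + 2) * (m + 3) * (m - 1) * (m - 2) / 72 *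
          (n ^ 2 * (n + 1) ^ 2 * (n + 2) * (n - 1) / 144) +
        m ^ 2 * (m + 1) ^ 2 * (m + 2) * (m - 1) / 144 *
          (n * (n + 1) * (n + 2) * (n + 3) * (n - 1) * (n - 2) / 72) := by
  rw [finrank_eq_range]
  apply Nat.cast_injective (R := ℂ)
  rw [finrank_range_trace, trace_EE, Nat.cast_add, Nat.cast_mul, Nat.cast_mul, cast_e1 m hm,
    cast_e1 n hn, cast_e2 m hm, cast_e2 n hn]
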